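/- For any biconed graph G^{A,B} there is a bijection between the set of spanning trees of G^{A,B} and the set of 2-edge-rooted forests of G^{A,B}_red. -/

import Mathlib

/-!
Formalization scaffold for "h-vectors of graphic matroids of biconed graphs".

A graph `G` (loops and parallel edges allowed) with vertex set `A ∪ B` is
modelled by an abstract finite edge type `E` with an endpoint map
`ends : E → Sym2 (Fin m ⊕ₗ Fin n)`, where `A = Fin m = {1,…,m}`,
`Ā = B \ A = Fin n = {1̄,…,n̄}` and the finset `S ⊆ Fin m` records `A ∩ B`
(so `B = S ∪ Ā`).  The biconing `G^{A,B}` adds the two vertices `0` and `0̄`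
and the edges `00̄`, `0a (a ∈ A)` and `0̄b (b ∈ B)`.
-/

namespace BiconedPaper

noncomputable section
open scoped Classical

/-! ### Walks in multigraphs presented by an endpoint map -/

/-- A walk in the multigraph with edge set `ε` and endpoint map `ends`. -/
inductive MWalk {ε ν : Type} (ends : ε → Sym2 ν) : ν → ν → Type
  | nil (u : ν) : MWalk ends u u
  | cons {u w : ν} (e : ε) (v : ν) (h : ends e = s(u, v)) (p : MWalk ends v w) :
      MWalk ends u w

namespace MWalk

variable {ε ν : Type} {ends : ε → Sym2 ν}

/-- The list of edges traversed by a walk. -/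
def edges : ∀ {u v : ν}, MWalk ends u v → List ε
  | _, _, nil _ => []
  | _, _, cons e _ _ p => e :: p.edges

/-- The list of vertices visited by a walk. -/
def support : ∀ {u v : ν}, MWalk ends u v → List ν
  | u, _, nil _ => [u]
  | u, _, cons _ _ _ p => u :: p.support

/-- A walk is a path if it visits no vertex twice. -/
def IsPath {u v : ν} (p : MWalk ends u v) : Prop := p.support.Nodup

/-- All edges of the walk belong to the edge set `F`. -/
def edgesIn {u v : ν} (p : MWalk ends u v) (F : Finset ε) : Prop :=
  ∀ e ∈ p.edges, e ∈ F

/-- The number of "bridging" edges traversed by a walk, i.e. steps whose two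
endpoints lie on different sides according to `sideF`. -/
def bridgeCount (sideF : ν → Bool) : ∀ {u v : ν}, MWalk ends u v → ℕ
  | _, _, nil _ => 0
  | u, _, cons _ v' _ p => (if sideF u = sideF v' then 0 else 1) + p.bridgeCount sideF

end MWalk

/-- `u` and `v` are joined by a walk all of whose edges lie in `F`. -/
def Reachable {ε ν : Type} (ends : ε → Sym2 ν) (F : Finset ε) (u v : ν) : Prop :=
  ∃ p : MWalk ends u v, p.edgesIn F

/-- An edge set is acyclic (a forest) iff removing any one of its edges
disconnects the endpoints of that edge.  (In particular no loops and no
parallel pairs.) -/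
def IsAcyclic {ε ν : Type} [DecidableEq ε] (ends : ε → Sym2 ν) (F : Finset ε) : Prop :=
  ∀ e ∈ F, ∀ u v : ν, ends e = s(u, v) → ¬ Reachable ends (F.erase e) u v

/-- A spanning tree: an acyclic edge set connecting every pair of vertices. -/
def IsSpanningTree {ε ν : Type} [DecidableEq ε] (ends : ε → Sym2 ν) (T : Finset ε) : Prop :=
  IsAcyclic ends T ∧ ∀ u v : ν, Reachable ends T u v

/-! ### Biconed graphs -/

/-- The data of a biconed graph `G^{A,B}`:  the graph `G` has vertex set
`A ∪ B` with `A = Fin m`, `Ā = B \ A = Fin n`, `A ∩ B = S`, and abstract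
edge set `E` (so loops and parallel edges are allowed). -/
structure BiconedGraph where
  m : ℕ
  n : ℕ
  E : Type
  fintypeE : Fintype E
  decEqE : DecidableEq E
  ends : E → Sym2 (Fin m ⊕ₗ Fin n)
  S : Finset (Fin m)

namespace BiconedGraph

variable (P : BiconedGraph)

instance : Fintype P.E := P.fintypeE
instance : DecidableEq P.E := P.decEqE

/-- The vertices of `G`, linearly ordered `1 < ⋯ < m < 1̄ < ⋯ < n̄`. -/
abbrev VG := Fin P.m ⊕ₗ Fin P.n

/-- The vertices of `G^{A,B}_red`:  `⊥` is the vertex `0̄`, ordered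
`0̄ < 1 < ⋯ < m < 1̄ < ⋯ < n̄`. -/
abbrev Vred := WithBot P.VG

/-- The vertices of `G^{A,B}`: `⊥` is `0`, ordered `0 < 0̄ < 1 < ⋯ < n̄`. -/
abbrev W := WithBot P.Vred

/-- The vertex `a ∈ A`. -/
def aVert (a : Fin P.m) : P.VG := toLex (Sum.inl a)
/-- The vertex `b ∈ Ā`. -/
def bVert (b : Fin P.n) : P.VG := toLex (Sum.inr b)
/-- Inclusion of the vertices of `G` into those of `G^{A,B}_red`. -/
def liftV (x : P.VG) : P.Vred := (x : WithBot P.VG)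
/-- Inclusion of the vertices of `G^{A,B}_red` into those of `G^{A,B}`. -/
def liftW (x : P.Vred) : P.W := (x : WithBot P.Vred)

/-- The edges of the biconed graph `G^{A,B}`:  the edge `00̄`, the coning
edges `0a (a ∈ A)`, `0̄b (b ∈ Ā)`, `0̄a (a ∈ A ∩ B)`, and the edges of `G`. -/
abbrev EB := Unit ⊕ (Fin P.m ⊕ (Fin P.n ⊕ ({a : Fin P.m // a ∈ P.S} ⊕ P.E)))

/-- The edge `00̄`. -/
abbrev e00 : P.EB := Sum.inl ()
/-- The coning edge `0a`, `a ∈ A`. -/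
abbrev eA (a : Fin P.m) : P.EB := Sum.inr (Sum.inl a)
/-- The coning edge `0̄b`, `b ∈ Ā`. -/
abbrev eB (b : Fin P.n) : P.EB := Sum.inr (Sum.inr (Sum.inl b))
/-- The coning edge `0̄a`, `a ∈ A ∩ B`. -/
abbrev eS (a : {a : Fin P.m // a ∈ P.S}) : P.EB := Sum.inr (Sum.inr (Sum.inr (Sum.inl a)))
/-- An original edge of `G`. -/
abbrev eG (e : P.E) : P.EB := Sum.inr (Sum.inr (Sum.inr (Sum.inr e)))

/-- The endpoint map of `G^{A,B}`. -/
def endsB : P.EB → Sym2 P.W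
  | Sum.inl _ => s((⊥ : P.W), P.liftW ⊥)
  | Sum.inr (Sum.inl a) => s((⊥ : P.W), P.liftW (P.liftV (P.aVert a)))
  | Sum.inr (Sum.inr (Sum.inl b)) => s(P.liftW ⊥, P.liftW (P.liftV (P.bVert b)))
  | Sum.inr (Sum.inr (Sum.inr (Sum.inl a))) => s(P.liftW ⊥, P.liftW (P.liftV (P.aVert a.1)))
  | Sum.inr (Sum.inr (Sum.inr (Sum.inr e))) => (P.ends e).map fun x => P.liftW (P.liftV x)

/-- The spanning tree `T₀`, consisting of `00̄`, the edges `0a (a ∈ A)` and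
the edges `0̄b (b ∈ Ā)`. -/
def T0 : Finset P.EB :=
  Finset.univ.filter fun e => match e with
    | Sum.inl _ => True
    | Sum.inr (Sum.inl _) => True
    | Sum.inr (Sum.inr (Sum.inl _)) => True
    | _ => False

/-- The edges of `G^{A,B}_red` (delete the edges of `T₀` and the vertex `0`):
the edges `0̄a (a ∈ A ∩ B)` together with the edges of `G`. -/
abbrev Ered := {a : Fin P.m // a ∈ P.S} ⊕ P.E

/-- The endpoint map of `G^{A,B}_red`; `⊥` is the vertex `0̄`. -/
def endsRed : P.Ered → Sym2 P.Vred
  | Sum.inl a => s((⊥ : P.Vred), P.liftV (P.aVert a.1))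
  | Sum.inr e => (P.ends e).map P.liftV

/-- Inclusion of the edges of `G^{A,B}_red` into those of `G^{A,B}`. -/
def redToEB : P.Ered → P.EB
  | Sum.inl a => P.eS a
  | Sum.inr e => P.eG e

/-- The edge set `T \ T₀` of `T`, viewed inside `G^{A,B}_red`. -/
def redOf (T : Finset P.EB) : Finset P.Ered :=
  Finset.univ.filter fun e => P.redToEB e ∈ T

/-- `true` on the vertices of `A`, `false` on the vertices of `Ā ∪ {0̄}`. -/
def side : P.Vred → Bool :=
  WithBot.recBotCoe false fun x => Sum.elim (fun _ => true) (fun _ => false) (ofLex x)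

/-- The vertex lies in `A`. -/
def InA (v : P.Vred) : Prop := ∃ a : Fin P.m, v = P.liftV (P.aVert a)

/-- An edge of `G^{A,B}_red` is bridging if it joins a vertex of `A` to a
vertex of `Ā ∪ {0̄}`. -/
def BridgingE (e : P.Ered) : Prop :=
  ∃ u v : P.Vred, P.endsRed e = s(u, v) ∧ P.side u ≠ P.side v

/-! ### 2-edge-rooted forests -/

/-- The underlying edge set `F` of the multiset of edges given by the
multiplicity function `mult` (an edge `e` carries `mult e - 1` edge roots). -/
def mSupport (mult : P.Ered → ℕ) : Finset P.Ered :=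
  Finset.univ.filter fun e => mult e ≠ 0

/-- The degree of the multiset of edges given by `mult`. -/
def deg (mult : P.Ered → ℕ) : ℕ := ∑ e : P.Ered, mult e

/-- Edge `e` meets the connected component of `v` in the edge set `F`. -/
def Touches (F : Finset P.Ered) (v : P.Vred) (e : P.Ered) : Prop :=
  ∃ u : P.Vred, u ∈ P.endsRed e ∧ Reachable P.endsRed F v u

/-- The total number of edge roots in the component of `v`. -/
def compEdgeRoots (mult : P.Ered → ℕ) (v : P.Vred) : ℕ :=
  ∑ e ∈ P.mSupport mult, if P.Touches (P.mSupport mult) v e then mult e - 1 else 0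

/-- The component of `v` is `compCount`-edge-rooted:  the number of its edge
roots, plus `1` if it contains the vertex `0̄`. -/
def compCount (mult : P.Ered → ℕ) (v : P.Vred) : ℕ :=
  P.compEdgeRoots mult v +
    if Reachable P.endsRed (P.mSupport mult) v (⊥ : P.Vred) then 1 else 0

/-- Condition (C3) for the `2`-edge-rooted component of `v`:  the unique
shortest path containing both edge roots (resp. the vertex `0̄` and the edge
root, if the component contains `0̄`) has an odd number of bridging edges.
The shortest path containing two edges is the unique path whose first and
last edges are the two rooted edges; if the two edge roots lie on one common
edge (`mult e = 3`) the path is that single edge. -/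
def C3At (mult : P.Ered → ℕ) (v : P.Vred) : Prop :=
  (Reachable P.endsRed (P.mSupport mult) v (⊥ : P.Vred) →
    ∃ (x : P.Vred) (p : MWalk P.endsRed (⊥ : P.Vred) x),
      p.IsPath ∧ p.edgesIn (P.mSupport mult) ∧
      (∃ e, p.edges.getLast? = some e ∧ 2 ≤ mult e) ∧
      Odd (p.bridgeCount P.side)) ∧
  (¬ Reachable P.endsRed (P.mSupport mult) v (⊥ : P.Vred) →
    ∃ (x y : P.Vred) (p : MWalk P.endsRed x y),
      p.IsPath ∧ p.edgesIn (P.mSupport mult) ∧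
      Reachable P.endsRed (P.mSupport mult) v x ∧
      (∃ e, p.edges.head? = some e ∧ 2 ≤ mult e) ∧
      (∃ e, p.edges.getLast? = some e ∧ 2 ≤ mult e) ∧
      (∀ e, p.edges = [e] → mult e = 3) ∧
      Odd (p.bridgeCount P.side))

/-- `mult : Ered → ℕ` is (the multiplicity function of) a 2-edge-rooted
forest of `G^{A,B}_red`:
(C0) its support is a spanning forest;
(C1) at most one component is `2`-edge-rooted;
(C2) every other component is `0`- or `1`-edge-rooted;
(C3) the parity condition on the path joining the two roots. -/
def Is2ERF (mult : P.Ered → ℕ) : Prop :=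
  IsAcyclic P.endsRed (P.mSupport mult) ∧
  (∀ v : P.Vred, P.compCount mult v ≤ 2) ∧
  (∀ u v : P.Vred, P.compCount mult u = 2 → P.compCount mult v = 2 →
    Reachable P.endsRed (P.mSupport mult) u v) ∧
  (∀ v : P.Vred, P.compCount mult v = 2 → P.C3At mult v)

/-! ### Birooted forests -/

/-- `(F, R)` is a birooted forest of `G^{A,B}_red`:  `F` is a spanning forest,
the root set `R` contains `0̄`, every component of `F` contains at least one
root, no component contains three roots, at most one component contains two
roots, and a component with two roots has one root in `A` and the other in
`Ā ∪ {0̄}`. -/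
def IsBirootedForest (F : Finset P.Ered) (R : Set P.Vred) : Prop :=
  IsAcyclic P.endsRed F ∧
  (⊥ : P.Vred) ∈ R ∧
  (∀ v : P.Vred, ∃ r ∈ R, Reachable P.endsRed F v r) ∧
  (∀ r₁ ∈ R, ∀ r₂ ∈ R, ∀ r₃ ∈ R, r₁ ≠ r₂ → r₁ ≠ r₃ → r₂ ≠ r₃ →
    Reachable P.endsRed F r₁ r₂ → Reachable P.endsRed F r₁ r₃ → False) ∧
  (∀ r₁ ∈ R, ∀ r₂ ∈ R, ∀ r₃ ∈ R, ∀ r₄ ∈ R, r₁ ≠ r₂ → r₃ ≠ r₄ →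
    Reachable P.endsRed F r₁ r₂ → Reachable P.endsRed F r₃ r₄ →
    Reachable P.endsRed F r₁ r₃) ∧
  (∀ r₁ ∈ R, ∀ r₂ ∈ R, r₁ ≠ r₂ → Reachable P.endsRed F r₁ r₂ →
    (P.InA r₁ ∧ ¬ P.InA r₂) ∨ (P.InA r₂ ∧ ¬ P.InA r₁))

/-! ### Internal activity and the edge order -/

/-- `e` is internally passive in the spanning tree `T`:  it can be exchanged
for a strictly smaller edge `f` so that the result is again a spanning tree. -/
def InternallyPassive (ord : LinearOrder P.EB) (T : Finset P.EB) (e : P.EB) : Prop :=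
  e ∈ T ∧ ∃ f : P.EB, ord.lt f e ∧ IsSpanningTree P.endsB (insert f (T.erase e))

/-- `e` is internally active in the spanning tree `T`. -/
def InternallyActive (ord : LinearOrder P.EB) (T : Finset P.EB) (e : P.EB) : Prop :=
  e ∈ T ∧ ¬ ∃ f : P.EB, ord.lt f e ∧ IsSpanningTree P.endsB (insert f (T.erase e))

/-- The number of internally passive edges of `T`. -/
def ipCount (ord : LinearOrder P.EB) (T : Finset P.EB) : ℕ :=
  (T.filter fun e => P.InternallyPassive ord T e).card

/-- The smaller endpoint of an edge of `G^{A,B}`. -/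
def endMin (e : P.EB) : P.W := Sym2.lift ⟨fun a b => a ⊓ b, fun a b => inf_comm a b⟩ (P.endsB e)
/-- The larger endpoint of an edge of `G^{A,B}`. -/
def endMax (e : P.EB) : P.W := Sym2.lift ⟨fun a b => a ⊔ b, fun a b => sup_comm a b⟩ (P.endsB e)

/-- The endpoints of an edge, as an ordered pair in the lexicographic square
of the vertex order `0 < 0̄ < 1 < ⋯ < m < 1̄ < ⋯ < n̄`. -/
def lexEnds (e : P.EB) : P.W ×ₗ P.W := toLex (P.endMin e, P.endMax e)

/-- A linear order on the edges of `G^{A,B}` is admissible if it refines the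
lexicographic order on endpoints (so parallel edges are ordered arbitrarily). -/
def AdmissibleOrder (ord : LinearOrder P.EB) : Prop :=
  ∀ e f : P.EB, P.lexEnds e < P.lexEnds f → ord.lt e f

/-- `v` is a connecting vertex of `T`:  `v ∈ A` and `v` is adjacent to `0` in
`T`, or `v ∈ Ā` and `v` is adjacent to `0̄` in `T`. -/
def ConnVertex (T : Finset P.EB) (v : P.Vred) : Prop :=
  (∃ a : Fin P.m, v = P.liftV (P.aVert a) ∧ P.eA a ∈ T) ∨
  (∃ b : Fin P.n, v = P.liftV (P.bVert b) ∧ P.eB b ∈ T)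

/-- `e` is a connecting edge of `T` (an edge `0a`, `a ∈ A`, or `0̄b`, `b ∈ Ā`)
with connecting vertex `v`. -/
def ConnEdge (T : Finset P.EB) (e : P.EB) (v : P.Vred) : Prop :=
  e ∈ T ∧ ((∃ a : Fin P.m, e = P.eA a ∧ v = P.liftV (P.aVert a)) ∨
           (∃ b : Fin P.n, e = P.eB b ∧ v = P.liftV (P.bVert b)))

/-! ### The h-vector -/

/-- `f_{i-1}`:  the number of acyclic edge sets of cardinality `i` in `G^{A,B}`. -/
def numAcyclic (i : ℕ) : ℕ :=
  Nat.card {F : Finset P.EB // IsAcyclic P.endsB F ∧ F.card = i}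

/-- The rank of the graphic matroid of `G^{A,B}`:  `|V| - 1 = m + n + 1`. -/
def d : ℕ := P.m + P.n + 1

/-- `h` is the h-vector of the graphic matroid of `G^{A,B}`:  it satisfies
`Σ_{i=0}^{d} f_{i-1} (t-1)^{d-i} = Σ_{k=0}^{d} h_k t^{d-k}`. -/
def IsHVector (h : ℕ → ℤ) : Prop :=
  ∑ i ∈ Finset.range (P.d + 1),
      Polynomial.C ((P.numAcyclic i : ℤ)) * (Polynomial.X - 1) ^ (P.d - i)
    = ∑ k ∈ Finset.range (P.d + 1), Polynomial.C (h k) * Polynomial.X ^ (P.d - k)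

end BiconedGraph

/-- `(h 0, …, h d)` is a pure O-sequence:  there is a multicomplex `M` of
multisets on a finite ground set (nonempty, closed under sub-multisets), all
of whose inclusion-maximal members have the same cardinality, whose members
all have cardinality at most `d`, and which has exactly `h i` members of
cardinality `i` for every `i ≤ d`. -/
def IsPureOSeq (d : ℕ) (h : ℕ → ℤ) : Prop :=
  ∃ (N : ℕ) (M : Set (Multiset (Fin N))),
    M.Nonempty ∧
    (∀ s ∈ M, ∀ t : Multiset (Fin N), t ≤ s → t ∈ M) ∧
    (∀ s ∈ M, ∀ t ∈ M, (∀ u ∈ M, s ≤ u → u = s) → (∀ u ∈ M, t ≤ u → u = t) →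
      Multiset.card s = Multiset.card t) ∧
    (∀ s ∈ M, Multiset.card s ≤ d) ∧
    (∀ i ≤ d, (Nat.card {s : Multiset (Fin N) // s ∈ M ∧ Multiset.card s = i} : ℤ) = h i)


/-! ### Generic multigraph lemmas -/

section Generic

variable {ε ν : Type} {ends : ε → Sym2 ν}

lemma reach_refl (F : Finset ε) (u : ν) : Reachable ends F u u :=
  ⟨MWalk.nil u, by intro e he; simp [MWalk.edges] at he⟩

lemma reach_cons {F : Finset ε} {u v w : ν} {e : ε} (he : e ∈ F) (h : ends e = s(u, v))
    (hr : Reachable ends F v w) : Reachable ends F u w := by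
  obtain ⟨p, hp⟩ := hr
  refine ⟨MWalk.cons e v h p, ?_⟩
  intro f hf
  simp only [MWalk.edges, List.mem_cons] at hf
  rcases hf with rfl | hf
  · exact he
  · exact hp _ hf

lemma reach_edge {F : Finset ε} {u v : ν} {e : ε} (he : e ∈ F) (h : ends e = s(u, v)) :
    Reachable ends F u v := reach_cons he h (reach_refl F v)

lemma reach_head_ind {F : Finset ε} {w : ν} {X : ν → Prop} (h0 : X w)
    (hs : ∀ e ∈ F, ∀ u v, ends e = s(u, v) → Reachable ends F v w → X v → X u) {u : ν}
    (hr : Reachable ends F u w) : X u := by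
  obtain ⟨p, hp⟩ := hr
  induction p with
  | nil u => exact h0
  | cons e v h p ih =>
    have hp' : p.edgesIn F := fun f hf => hp f (by simp [MWalk.edges, hf])
    exact hs e (hp e (by simp [MWalk.edges])) _ _ h ⟨p, hp'⟩ (ih h0 hs hp')

lemma reach_trans {F : Finset ε} {u v w : ν} (h1 : Reachable ends F u v)
    (h2 : Reachable ends F v w) : Reachable ends F u w :=
  reach_head_ind (X := fun x => Reachable ends F x w) h2
    (fun _ he _ _ h _ hx => reach_cons he h hx) h1

lemma reach_symm {F : Finset ε} {u v : ν} (h1 : Reachable ends F u v) :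
    Reachable ends F v u :=
  reach_head_ind (X := fun x => Reachable ends F v x) (reach_refl F v)
    (fun e he a b h _ hx => reach_trans hx (reach_edge he (by rw [h, Sym2.eq_swap]))) h1

lemma reach_inv {F : Finset ε} {X : ν → Prop}
    (hs : ∀ e ∈ F, ∀ u v, ends e = s(u, v) → X u → X v) {u w : ν}
    (hr : Reachable ends F u w) (h0 : X u) : X w :=
  reach_head_ind (X := X) h0 (fun e he a b h _ hb => hs e he b a (by rw [h, Sym2.eq_swap]) hb)
    (reach_symm hr)

lemma reach_of_edges {ε' : Type} {ν' : Type} {ends' : ε' → Sym2 ν'} {F : Finset ε}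
    {F' : Finset ε'} (φ : ν → ν')
    (hs : ∀ e ∈ F, ∀ u v, ends e = s(u, v) → Reachable ends' F' (φ u) (φ v)) {u v : ν}
    (hr : Reachable ends F u v) : Reachable ends' F' (φ u) (φ v) :=
  reach_inv (X := fun x => Reachable ends' F' (φ u) (φ x))
    (fun e he a b h ha => reach_trans ha (hs e he a b h)) hr (reach_refl _ _)

lemma reach_mono {F F' : Finset ε} (hFF : F ⊆ F') {u v : ν} (hr : Reachable ends F u v) :
    Reachable ends F' u v :=
  reach_of_edges id (fun _ he _ _ h => reach_edge (hFF he) h) hr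

variable [DecidableEq ε]

lemma reach_split {F : Finset ε} {e : ε} {a b u v : ν} (he : ends e = s(a, b))
    (hr : Reachable ends F u v) :
    Reachable ends (F.erase e) u v ∨
    (Reachable ends (F.erase e) u a ∧ Reachable ends (F.erase e) b v) ∨
    (Reachable ends (F.erase e) u b ∧ Reachable ends (F.erase e) a v) := by
  refine reach_inv (X := fun y => Reachable ends (F.erase e) u y ∨
    (Reachable ends (F.erase e) u a ∧ Reachable ends (F.erase e) b y) ∨
    (Reachable ends (F.erase e) u b ∧ Reachable ends (F.erase e) a y)) ?_ hr
    (Or.inl (reach_refl _ _))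
  intro g hg x y hxy hx
  by_cases hge : g = e
  · subst hge
    rw [he, Sym2.eq_iff] at hxy
    have ra := reach_refl (ends := ends) (F.erase g) a
    have rb := reach_refl (ends := ends) (F.erase g) b
    rcases hxy with ⟨rfl, rfl⟩ | ⟨rfl, rfl⟩ <;> tauto
  · have hr' : Reachable ends (F.erase e) x y := reach_edge (Finset.mem_erase.2 ⟨hge, hg⟩) hxy
    rcases hx with hx | ⟨h1, h2⟩ | ⟨h1, h2⟩
    · exact Or.inl (reach_trans hx hr')
    · exact Or.inr (Or.inl ⟨h1, reach_trans h2 hr'⟩)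
    · exact Or.inr (Or.inr ⟨h1, reach_trans h2 hr'⟩)

lemma acyclic_mono {F F' : Finset ε} (h : IsAcyclic ends F') (hF : F ⊆ F') :
    IsAcyclic ends F :=
  fun e he u v huv hr => h e (hF he) u v huv (reach_mono (Finset.erase_subset_erase _ hF) hr)

lemma acyclic_insert {F : Finset ε} (h : IsAcyclic ends F) {f : ε} {a b : ν}
    (hf : ends f = s(a, b)) (hab : ¬ Reachable ends F a b) :
    IsAcyclic ends (insert f F) := by
  have hfF : f ∉ F := fun hm => hab (reach_edge hm hf)
  intro g hg u v huv hr
  by_cases hgf : g = f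
  · subst hgf
    rw [Finset.erase_insert hfF] at hr
    rw [hf, Sym2.eq_iff] at huv
    rcases huv with ⟨rfl, rfl⟩ | ⟨rfl, rfl⟩
    · exact hab hr
    · exact hab (reach_symm hr)
  · have hgF : g ∈ F := (Finset.mem_insert.1 hg).resolve_left hgf
    have hsub : ((insert f F).erase g).erase f ⊆ F.erase g := by
      intro x hx
      simp only [Finset.mem_erase, Finset.mem_insert] at hx ⊢
      tauto
    have hsub2 : F.erase g ⊆ F := Finset.erase_subset _ _
    have huvF : Reachable ends F u v := reach_edge hgF huv
    rcases reach_split hf hr with h1 | ⟨h1, h2⟩ | ⟨h1, h2⟩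
    · exact h g hgF u v huv (reach_mono hsub h1)
    · have h1' := reach_mono (hsub.trans hsub2) h1
      have h2' := reach_mono (hsub.trans hsub2) h2
      exact hab (reach_trans (reach_symm h1') (reach_trans huvF (reach_symm h2')))
    · have h1' := reach_mono (hsub.trans hsub2) h1
      have h2' := reach_mono (hsub.trans hsub2) h2
      exact hab (reach_trans h2' (reach_trans (reach_symm huvF) h1'))

lemma tree_exchange {T : Finset ε} (h : IsSpanningTree ends T) {e f : ε} {u v a b : ν}
    (heT : e ∈ T) (he : ends e = s(u, v)) (hf : ends f = s(a, b))
    (h1 : Reachable ends (T.erase e) u a) (h2 : Reachable ends (T.erase e) b v) :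
    IsSpanningTree ends (insert f (T.erase e)) := by
  have hsub : T.erase e ⊆ insert f (T.erase e) := Finset.subset_insert _ _
  constructor
  · refine acyclic_insert (acyclic_mono h.1 (Finset.erase_subset _ _)) hf ?_
    intro hab
    exact h.1 e heT u v he (reach_trans h1 (reach_trans hab h2))
  · intro x y
    refine reach_of_edges id ?_ (h.2 x y)
    intro g hg p q hpq
    by_cases hge : g = e
    · subst hge
      have huv : Reachable ends (insert f (T.erase g)) u v :=
        reach_trans (reach_mono hsub h1) (reach_trans
          (reach_edge (Finset.mem_insert_self _ _) hf) (reach_mono hsub h2))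
      rw [he, Sym2.eq_iff] at hpq
      rcases hpq with ⟨rfl, rfl⟩ | ⟨rfl, rfl⟩
      · exact huv
      · exact reach_symm huv
    · exact reach_edge (hsub (Finset.mem_erase.2 ⟨hge, hg⟩)) hpq

/-- `e` is the first edge on the `F`-path from `u` to `v`. -/
def Pt (ends : ε → Sym2 ν) (F : Finset ε) (u v : ν) (e : ε) : Prop :=
  e ∈ F ∧ ∃ w, ends e = s(u, w) ∧ Reachable ends (F.erase e) w v

lemma Pt.reach {F : Finset ε} {u v : ν} {e : ε} (h : Pt ends F u v e) :
    Reachable ends F u v := by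
  obtain ⟨he, w, hw, hr⟩ := h
  exact reach_cons he hw (reach_mono (Finset.erase_subset _ _) hr)

lemma Pt.ne {F : Finset ε} (hF : IsAcyclic ends F) {u v : ν} {e : ε} (h : Pt ends F u v e) :
    u ≠ v := by
  rintro rfl
  obtain ⟨he, w, hw, hr⟩ := h
  exact hF e he u w hw (reach_symm hr)

lemma Pt.edge_unique {F : Finset ε} (hF : IsAcyclic ends F) {u v : ν} {e f : ε}
    (h : Pt ends F u v e) (h' : Pt ends F u v f) : e = f := by
  by_contra hne
  obtain ⟨he, w, hw, hr⟩ := h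
  obtain ⟨hf, w', hw', hr'⟩ := h'
  have hvu : ¬ Reachable ends (F.erase e) v u := fun hx =>
    hF e he u w hw (reach_symm (reach_trans hr hx))
  have key : Reachable ends (F.erase f) v w ∧ Reachable ends (F.erase e) v w := by
    refine reach_inv (X := fun y => Reachable ends (F.erase f) v y ∧
      Reachable ends (F.erase e) v y) ?_ (reach_symm hr) ⟨reach_refl _ _, reach_refl _ _⟩
    rintro g hg x y hxy ⟨hx1, hx2⟩
    have hy2 := reach_trans hx2 (reach_edge hg hxy)
    have hgf : g ≠ f := by
      rintro rfl
      rw [hw', Sym2.eq_iff] at hxy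
      rcases hxy with ⟨rfl, rfl⟩ | ⟨rfl, rfl⟩
      · exact hvu hx2
      · exact hvu hy2
    exact ⟨reach_trans hx1 (reach_edge
      (Finset.mem_erase.2 ⟨hgf, (Finset.mem_erase.1 hg).2⟩) hxy), hy2⟩
  have h3 : Reachable ends (F.erase f) u w := reach_edge (Finset.mem_erase.2 ⟨hne, he⟩) hw
  exact hF f hf u w' hw' (reach_trans h3 (reach_trans (reach_symm key.1) (reach_symm hr')))

lemma Pt.vert_unique {F : Finset ε} (hF : IsAcyclic ends F) {u u' v : ν} {e : ε}
    (h : Pt ends F u v e) (h' : Pt ends F u' v e) : u = u' := by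
  obtain ⟨he, w, hw, hr⟩ := h
  obtain ⟨_, w', hw', hr'⟩ := h'
  have := hw
  rw [hw', Sym2.eq_iff] at this
  rcases this with ⟨h1, _⟩ | ⟨_, h2⟩
  · exact h1.symm
  · subst h2
    exact absurd (reach_trans hr' (reach_symm hr)) (hF e he _ _ hw)

lemma Pt.exists_vert {F : Finset ε} {e : ε} (he : e ∈ F) {a v : ν} (ha : a ∈ ends e)
    (hr : Reachable ends F v a) : ∃ u, Pt ends F u v e := by
  obtain ⟨b, hb⟩ := Sym2.mem_iff_exists.1 ha
  rcases reach_split hb (reach_symm hr) with h | ⟨_, h⟩ | ⟨_, h⟩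
  · exact ⟨b, he, a, by rw [hb, Sym2.eq_swap], h⟩
  · exact ⟨a, he, b, hb, h⟩
  · exact ⟨b, he, a, by rw [hb, Sym2.eq_swap], h⟩

lemma Pt.pair_unique {F : Finset ε} (hF : IsAcyclic ends F) {u v u' v' : ν} {e f : ε}
    (hne : e ≠ f) (h1 : Pt ends F u v e) (h2 : Pt ends F v u f) (h1' : Pt ends F u' v' e)
    (h2' : Pt ends F v' u' f) : u = u' := by
  obtain ⟨hf, w, hw, _⟩ := h2
  obtain ⟨_, w', hw', _⟩ := h2'
  have hfe : f ∈ F.erase e := Finset.mem_erase.2 ⟨hne.symm, hf⟩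
  have hvv : Reachable ends (F.erase e) v' v := by
    have := hw
    rw [hw', Sym2.eq_iff] at this
    rcases this with ⟨rfl, _⟩ | ⟨rfl, rfl⟩
    · exact reach_refl _ _
    · exact reach_edge hfe hw'
  obtain ⟨he, z, hz, hr⟩ := h1'
  exact Pt.vert_unique hF h1 ⟨he, z, hz, reach_trans hr hvv⟩

lemma Pt.pair_eq {F : Finset ε} (hF : IsAcyclic ends F) {u v : ν} {e : ε}
    (h1 : Pt ends F u v e) (h2 : Pt ends F v u e) : ends e = s(u, v) := by
  have hne := h1.ne hF
  obtain ⟨he, w, hw, _⟩ := h1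
  obtain ⟨_, w', hw', _⟩ := h2
  have := hw
  rw [hw', Sym2.eq_iff] at this
  rcases this with ⟨rfl, _⟩ | ⟨rfl, rfl⟩
  · exact absurd rfl hne
  · exact hw

/-! Paths -/

lemma mem_support_of_edge {u v x y : ν} (p : MWalk ends u v) {e : ε} (he : e ∈ p.edges)
    (h : ends e = s(x, y)) : x ∈ p.support := by
  induction p with
  | nil u => simp [MWalk.edges] at he
  | @cons a c f b hf p ih =>
    simp only [MWalk.edges, List.mem_cons] at he
    simp only [MWalk.support, List.mem_cons]
    rcases he with rfl | he
    · rw [hf, Sym2.eq_iff] at h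
      rcases h with ⟨rfl, _⟩ | ⟨_, rfl⟩
      · exact Or.inl rfl
      · right
        cases p <;> simp [MWalk.support]
    · exact Or.inr (ih he)

lemma exists_path {F : Finset ε} {u v : ν} (h : Reachable ends F u v) :
    ∃ p : MWalk ends u v, p.IsPath ∧ p.edgesIn F := by
  have suffix : ∀ {a b : ν} (p : MWalk ends a b), p.IsPath → p.edgesIn F → ∀ x ∈ p.support,
      ∃ q : MWalk ends x b, q.IsPath ∧ q.edgesIn F := by
    intro a b p
    induction p with
    | nil a =>
      intro h1 h2 x hx
      simp only [MWalk.support, List.mem_singleton] at hx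
      subst hx
      exact ⟨_, h1, h2⟩
    | cons e w hw p ih =>
      intro h1 h2 x hx
      simp only [MWalk.support, List.mem_cons] at hx
      rcases hx with rfl | hx
      · exact ⟨_, h1, h2⟩
      · refine ih ?_ ?_ x hx
        · simp only [MWalk.IsPath, MWalk.support, List.nodup_cons] at h1
          exact h1.2
        · exact fun f hf => h2 f (by simp [MWalk.edges, hf])
  refine reach_head_ind (X := fun x => ∃ p : MWalk ends x v, p.IsPath ∧ p.edgesIn F)
    ⟨MWalk.nil v, by simp [MWalk.IsPath, MWalk.support],
      by intro f hf; simp [MWalk.edges] at hf⟩ ?_ h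
  rintro e he a b hab - ⟨p, hp1, hp2⟩
  by_cases ha : a ∈ p.support
  · exact suffix p hp1 hp2 a ha
  · refine ⟨MWalk.cons e b hab p, ?_, ?_⟩
    · simp only [MWalk.IsPath, MWalk.support, List.nodup_cons]
      exact ⟨ha, hp1⟩
    · intro f hf
      simp only [MWalk.edges, List.mem_cons] at hf
      rcases hf with rfl | hf
      · exact he
      · exact hp2 f hf

lemma path_head_pt {F : Finset ε} {u v : ν} (p : MWalk ends u v) (hp : p.IsPath)
    (hF : p.edgesIn F) {e : ε} (he : p.edges.head? = some e) : Pt ends F u v e := by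
  cases p with
  | nil => simp [MWalk.edges] at he
  | cons f w hw p =>
    simp only [MWalk.edges, List.head?_cons, Option.some.injEq] at he
    subst he
    simp only [MWalk.IsPath, MWalk.support, List.nodup_cons] at hp
    refine ⟨hF _ (by simp [MWalk.edges]), w, hw, p, ?_⟩
    intro g hg
    refine Finset.mem_erase.2 ⟨?_, hF g (by simp [MWalk.edges, hg])⟩
    rintro rfl
    exact hp.1 (mem_support_of_edge p hg hw)

lemma path_last_pt {F : Finset ε} {u v : ν} (p : MWalk ends u v) (hp : p.IsPath)
    (hF : p.edgesIn F) {e : ε} (he : p.edges.getLast? = some e) : Pt ends F v u e := by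
  induction p with
  | nil => simp [MWalk.edges] at he
  | @cons a c f w hw p ih =>
    simp only [MWalk.IsPath, MWalk.support, List.nodup_cons] at hp
    have hf : f ∈ F := hF _ (by simp [MWalk.edges])
    have hF' : p.edgesIn F := fun g hg => hF g (by simp [MWalk.edges, hg])
    cases hpe : p.edges with
    | nil =>
      simp only [MWalk.edges, hpe, List.getLast?_singleton, Option.some.injEq] at he
      subst he
      cases p with
      | nil => exact ⟨hf, _, by rw [hw, Sym2.eq_swap], reach_refl _ _⟩
      | cons => simp [MWalk.edges] at hpe
    | cons g l =>
      have he' : p.edges.getLast? = some e := by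
        rw [hpe]
        simpa [MWalk.edges, hpe, List.getLast?_cons_cons] using he
      obtain ⟨h1, z, hz, hr⟩ := ih hp.2 hF' he'
      refine ⟨h1, z, hz, reach_trans hr (reach_symm (reach_edge ?_ hw))⟩
      refine Finset.mem_erase.2 ⟨?_, hf⟩
      rintro rfl
      exact hp.1 (mem_support_of_edge p (List.mem_of_getLast? he') hw)

lemma Pt.exists_edge {F : Finset ε} {u v : ν} (h : Reachable ends F u v) (hne : u ≠ v) :
    ∃ e, Pt ends F u v e := by
  obtain ⟨p, hp, hF⟩ := exists_path h
  cases hpe : p.edges with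
  | nil =>
    cases p with
    | nil => exact absurd rfl hne
    | cons => simp [MWalk.edges] at hpe
  | cons g l => exact ⟨g, path_head_pt p hp hF (by simp [hpe])⟩

lemma odd_bridge (sd : ν → Bool) {u v : ν} (p : MWalk ends u v) :
    Odd (p.bridgeCount sd) ↔ sd u ≠ sd v := by
  induction p with
  | nil => simp [MWalk.bridgeCount]
  | @cons a c f w hw p ih =>
    simp only [MWalk.bridgeCount]
    by_cases h : sd a = sd w
    · simp [h, ih]
    · rw [if_neg h, add_comm, Nat.odd_add_one, ih]
      revert h
      cases sd a <;> cases sd w <;> cases sd c <;> simp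

/-- Existence of a path with prescribed first and last edges and parity. -/
lemma exists_path_iff {F : Finset ε} (hF : IsAcyclic ends F) (sd : ν → Bool) (u v : ν) (e f : ε) :
    (∃ p : MWalk ends u v, p.IsPath ∧ p.edgesIn F ∧ p.edges.head? = some e ∧
      p.edges.getLast? = some f ∧ Odd (p.bridgeCount sd)) ↔
    (Pt ends F u v e ∧ Pt ends F v u f ∧ sd u ≠ sd v) := by
  constructor
  · rintro ⟨p, h1, h2, h3, h4, h5⟩
    exact ⟨path_head_pt p h1 h2 h3, path_last_pt p h1 h2 h4, (odd_bridge sd p).1 h5⟩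
  · rintro ⟨h1, h2, h3⟩
    obtain ⟨p, hp, hpF⟩ := exists_path h1.reach
    refine ⟨p, hp, hpF, ?_, ?_, (odd_bridge sd p).2 h3⟩
    · cases hpe : p.edges.head? with
      | none =>
        cases p with
        | nil => exact absurd rfl (h1.ne hF)
        | cons => simp [MWalk.edges] at hpe
      | some g => rw [Pt.edge_unique hF h1 (path_head_pt p hp hpF hpe)]
    · cases hpe : p.edges.getLast? with
      | none =>
        cases p with
        | nil => exact absurd rfl (h1.ne hF)
        | cons => simp [MWalk.edges] at hpe
      | some g => rw [Pt.edge_unique hF h2 (path_last_pt p hp hpF hpe)]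

end Generic

/-! ### The local bijection -/

section Local

variable {ε ν : Type} [DecidableEq ε] [Fintype ε]

/-- Local vertex configurations. -/
def VOK (ends : ε → Sym2 ν) (F : Finset ε) (b : ν) (sd : ν → Bool) (c : ν)
    (p : ν × Option ν) : Prop :=
  Reachable ends F p.1 c ∧ (c = b → p.1 = b) ∧
    ∀ a, p.2 = some a → Reachable ends F a c ∧ sd a = true ∧ sd p.1 = false

/-- The edge roots associated with a local vertex configuration. -/
def ext (ends : ε → Sym2 ν) (F : Finset ε) (b c : ν) (p : ν × Option ν) (e : ε) : ℕ :=
  match p.2 with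
  | none => if Pt ends F p.1 c e then 1 else 0
  | some a => (if Pt ends F a p.1 e then 1 else 0) +
      (if p.1 ≠ b ∧ Pt ends F p.1 a e then 1 else 0)

/-- The number of roots. -/
def cnt (b c : ν) (k : ε → ℕ) : ℕ := ∑ e, k e + if c = b then 1 else 0

/-- The local parity condition. -/
def C3loc (ends : ε → Sym2 ν) (F : Finset ε) (b : ν) (sd : ν → Bool) (c : ν)
    (k : ε → ℕ) : Prop :=
  (c = b → ∃ x e, Pt ends F x b e ∧ 1 ≤ k e ∧ sd x = true) ∧
  (c ≠ b → ∃ x y e f, Reachable ends F c x ∧ Pt ends F x y e ∧ Pt ends F y x f ∧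
    1 ≤ k e ∧ 1 ≤ k f ∧ (e = f → k e = 2) ∧ sd x ≠ sd y)

/-- Local edge configurations. -/
def MOK (ends : ε → Sym2 ν) (F : Finset ε) (b : ν) (sd : ν → Bool) (c : ν)
    (k : ε → ℕ) : Prop :=
  (∀ e, k e ≠ 0 → e ∈ F ∧ ∃ u ∈ ends e, Reachable ends F c u) ∧
  cnt b c k ≤ 2 ∧ (cnt b c k = 2 → C3loc ends F b sd c k)

variable {ends : ε → Sym2 ν} {F : Finset ε} {b c : ν} {sd : ν → Bool}

lemma pt_ite (hF : IsAcyclic ends F) {u v : ν} {e0 : ε} (h : Pt ends F u v e0) (e : ε) :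
    (if Pt ends F u v e then 1 else 0 : ℕ) = if e = e0 then 1 else 0 := by
  by_cases he : e = e0
  · subst he; simp [h]
  · rw [if_neg he, if_neg]
    exact fun h' => he (Pt.edge_unique hF h' h)

lemma eq_of_le_of_sum {k k' : ε → ℕ} (h : ∀ e, k' e ≤ k e) (hs : ∑ e, k' e = ∑ e, k e) :
    k' = k := by
  funext e
  exact (Finset.sum_eq_sum_iff_of_le (fun i _ => h i)).1 hs e (Finset.mem_univ e)

lemma Pt.mem_touch {u v : ν} {e : ε} (h : Pt ends F u v e) {c : ν}
    (hc : Reachable ends F u c) : e ∈ F ∧ ∃ u ∈ ends e, Reachable ends F c u := by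
  obtain ⟨he, w, hw, _⟩ := h
  exact ⟨he, u, by simp [hw], reach_symm hc⟩

lemma ext_none (hF : IsAcyclic ends F) {x : ν} (hx : VOK ends F b sd c (x, none)) :
    MOK ends F b sd c (ext ends F b c (x, none)) ∧ cnt b c (ext ends F b c (x, none)) ≤ 1 := by
  obtain ⟨h1, h2, -⟩ := hx
  simp only at h1 h2
  have hle : cnt b c (ext ends F b c (x, none)) ≤ 1 := by
    by_cases hxc : x = c
    · subst hxc
      have : ∀ e, ext ends F b x (x, none) e = 0 := by
        intro e
        simp only [ext]
        rw [if_neg]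
        exact fun h => h.ne hF rfl
      simp only [cnt, this]
      split_ifs <;> simp
    · have hcb : c ≠ b := fun h => hxc (by rw [h2 h, h])
      obtain ⟨e0, he0⟩ := Pt.exists_edge h1 hxc
      simp [cnt, ext, pt_ite hF he0, hcb]
  refine ⟨⟨?_, by omega, fun h => by omega⟩, hle⟩
  intro e he
  have : Pt ends F x c e := by
    by_contra h
    exact he (by simp [ext, h])
  exact this.mem_touch h1

lemma ext_some (hF : IsAcyclic ends F) (hb : sd b = false)
    (hc : Reachable ends F c b → c = b) {x a : ν} (hx : VOK ends F b sd c (x, some a)) :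
    MOK ends F b sd c (ext ends F b c (x, some a)) ∧
      cnt b c (ext ends F b c (x, some a)) = 2 := by
  obtain ⟨h1, h2, h3⟩ := hx
  obtain ⟨h3, h4, h5⟩ := h3 a rfl
  simp only at h1 h2 h5
  have hne : a ≠ x := by rintro rfl; rw [h4] at h5; cases h5
  have hr : Reachable ends F a x := reach_trans h3 (reach_symm h1)
  obtain ⟨e1, he1⟩ := Pt.exists_edge hr hne
  obtain ⟨e2, he2⟩ := Pt.exists_edge (reach_symm hr) hne.symm
  have htouch : ∀ e, ext ends F b c (x, some a) e ≠ 0 →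
      e ∈ F ∧ ∃ u ∈ ends e, Reachable ends F c u := by
    intro e he
    by_cases ha : Pt ends F a x e
    · exact ha.mem_touch h3
    · by_cases hx : Pt ends F x a e
      · exact hx.mem_touch h1
      · exact absurd (by simp [ext, ha, hx]) he
  by_cases hcb : c = b
  · have hxb := h2 hcb
    have hcnt : cnt b c (ext ends F b c (x, some a)) = 2 := by
      have hxb' : ¬ (x ≠ b) := fun h => h hxb
      simp only [cnt, ext, hxb', pt_ite hF he1, hcb, false_and, if_false, if_true, add_zero]
      simp
    refine ⟨⟨htouch, by omega, fun _ => ⟨fun _ => ?_, fun h => absurd hcb h⟩⟩, hcnt⟩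
    refine ⟨a, e1, hxb ▸ he1, ?_, h4⟩
    simp [ext, he1]
  · have hxb : x ≠ b := by
      rintro rfl
      exact hcb (hc (reach_symm h1))
    have hcnt : cnt b c (ext ends F b c (x, some a)) = 2 := by
      simp [cnt, ext, pt_ite hF he1, pt_ite hF he2, hxb, hcb, Finset.sum_add_distrib]
    refine ⟨⟨htouch, by omega, fun _ => ⟨fun h => absurd h hcb, fun _ => ?_⟩⟩, hcnt⟩
    refine ⟨a, x, e1, e2, reach_symm h3, he1, he2, ?_, ?_, ?_, ?_⟩
    · simp [ext, he1]
    · simp [ext, he2, hxb]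
    · rintro rfl
      simp [ext, he1, he2, hxb]
    · rw [h4, h5]; simp

lemma pair_ite {e1 e2 f1 f2 : ε}
    (h : ∀ e, ((if e = e1 then 1 else 0) + (if e = e2 then 1 else 0) : ℕ) =
      (if e = f1 then 1 else 0) + (if e = f2 then 1 else 0)) :
    (e1 = f1 ∧ e2 = f2) ∨ (e1 = f2 ∧ e2 = f1) := by
  have h1 := h e1
  have h2 := h e2
  have h3 := h f1
  have h4 := h f2
  by_cases a : e1 = f1
  · subst a
    left
    refine ⟨rfl, ?_⟩
    simpa using h2
  · right
    have ha : e1 = f2 := by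
      by_contra hb
      simp [a, hb] at h1
    subst ha
    refine ⟨rfl, ?_⟩
    by_contra hb
    simp [Ne.symm a, Ne.symm hb] at h3

lemma ext_inj (hF : IsAcyclic ends F) (hb : sd b = false)
    (hc : Reachable ends F c b → c = b) {p q : ν × Option ν} (hp : VOK ends F b sd c p)
    (hq : VOK ends F b sd c q) (h : ext ends F b c p = ext ends F b c q) : p = q := by
  obtain ⟨x, o⟩ := p
  obtain ⟨y, o'⟩ := q
  cases o with
  | none =>
    cases o' with
    | none =>
      obtain ⟨h1, -, -⟩ := hp
      obtain ⟨h1', -, -⟩ := hq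
      have hiff : ∀ e, Pt ends F x c e ↔ Pt ends F y c e := by
        intro e
        have := congrFun h e
        simp only [ext] at this
        by_cases hA : Pt ends F x c e <;> by_cases hB : Pt ends F y c e <;> simp_all
      by_cases hx : x = c
      · by_cases hy : y = c
        · rw [hx, hy]
        · obtain ⟨e, he⟩ := Pt.exists_edge h1' hy
          exact absurd hx (((hiff e).2 he).ne hF)
      · obtain ⟨e, he⟩ := Pt.exists_edge h1 hx
        have hxy : x = y := Pt.vert_unique hF he ((hiff e).1 he)
        rw [hxy]
    | some a =>
      have A := (ext_none hF hp).2
      have B := (ext_some hF hb hc hq).2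
      rw [h] at A
      omega
  | some a =>
    cases o' with
    | none =>
      have A := (ext_none hF hq).2
      have B := (ext_some hF hb hc hp).2
      rw [h] at B
      omega
    | some a' =>
      obtain ⟨h1, h2, h3⟩ := hp
      obtain ⟨h3, h4, h5⟩ := h3 a rfl
      obtain ⟨h1', h2', h3'⟩ := hq
      obtain ⟨h3', h4', h5'⟩ := h3' a' rfl
      simp only at h1 h2 h5 h1' h2' h5'
      have hne : a ≠ x := by rintro rfl; rw [h4] at h5; cases h5
      have hr : Reachable ends F a x := reach_trans h3 (reach_symm h1)
      obtain ⟨e1, he1⟩ := Pt.exists_edge hr hne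
      obtain ⟨e2, he2⟩ := Pt.exists_edge (reach_symm hr) hne.symm
      have hne' : a' ≠ y := by rintro rfl; rw [h4'] at h5'; cases h5'
      have hr' : Reachable ends F a' y := reach_trans h3' (reach_symm h1')
      obtain ⟨f1, hf1⟩ := Pt.exists_edge hr' hne'
      obtain ⟨f2, hf2⟩ := Pt.exists_edge (reach_symm hr') hne'.symm
      by_cases hcb : c = b
      · have hxb := h2 hcb
        have hyb := h2' hcb
        rw [hxb] at he1
        have := congrFun h e1
        have hP : Pt ends F a' b e1 := by
          by_contra hno
          simp [ext, hxb, hyb, he1, hno] at this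
        rw [Pt.vert_unique hF he1 hP, hxb, hyb]
      · have hxb : x ≠ b := by
          rintro rfl
          exact hcb (hc (reach_symm h1))
        have hyb : y ≠ b := by
          rintro rfl
          exact hcb (hc (reach_symm h1'))
        have hh : ∀ e, ((if e = e1 then 1 else 0) + (if e = e2 then 1 else 0) : ℕ) =
            (if e = f1 then 1 else 0) + (if e = f2 then 1 else 0) := by
          intro e
          have := congrFun h e
          simpa only [ext, hxb, hyb, ne_eq, not_false_eq_true, true_and, pt_ite hF he1,
            pt_ite hF he2, pt_ite hF hf1, pt_ite hF hf2] using this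
        by_cases he : e1 = e2
        · have hff : f1 = e1 ∧ f2 = e1 := by
            rcases pair_ite hh with ⟨r1, r2⟩ | ⟨r1, r2⟩ <;> constructor <;> simp_all
          obtain ⟨rfl, rfl⟩ := hff
          subst he
          have r1 := Pt.pair_eq hF he1 he2
          have r2 := Pt.pair_eq hF hf1 hf2
          rw [r1, Sym2.eq_iff] at r2
          rcases r2 with ⟨rfl, rfl⟩ | ⟨rfl, rfl⟩
          · rfl
          · rw [h4] at h5'; cases h5'
        · rcases pair_ite hh with ⟨rfl, rfl⟩ | ⟨rfl, rfl⟩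
          · rw [Pt.pair_unique hF he he1 he2 hf1 hf2,
              Pt.pair_unique hF (Ne.symm he) he2 he1 hf2 hf1]
          · have := Pt.pair_unique hF he he1 he2 hf2 hf1
            rw [this, h5'] at h4
            cases h4

lemma ext_surj (hF : IsAcyclic ends F) (hb : sd b = false)
    (hc : Reachable ends F c b → c = b) {k : ε → ℕ} (hk : MOK ends F b sd c k) :
    ∃ p, VOK ends F b sd c p ∧ ext ends F b c p = k := by
  obtain ⟨h1, h2, h3⟩ := hk
  by_cases h0 : ∑ e, k e = 0
  · refine ⟨(c, none), ⟨reach_refl _ _, fun h => h, by simp⟩, ?_⟩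
    funext e
    have hk0 : k e = 0 := (Finset.sum_eq_zero_iff.1 h0) e (Finset.mem_univ e)
    rw [hk0]
    simp only [ext]
    rw [if_neg]
    exact fun h => h.ne hF rfl
  · by_cases hcb : c = b
    · have hcnt : cnt b c k = 2 := by
        simp only [cnt, hcb, if_true] at h2 ⊢
        omega
      have hsum : ∑ e, k e = 1 := by simpa [cnt, hcb] using hcnt
      obtain ⟨x, e, hx, hke, hsx⟩ := (h3 hcnt).1 hcb
      refine ⟨(b, some x), ⟨by rw [hcb]; exact reach_refl _ _, fun _ => rfl, ?_⟩, ?_⟩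
      · intro a ha
        obtain rfl : x = a := by simpa using ha
        exact ⟨hcb ▸ hx.reach, hsx, hb⟩
      · have : ∀ e', ext ends F b c (b, some x) e' = if e' = e then 1 else 0 := by
          intro e'
          simp [ext, pt_ite hF hx]
        refine eq_of_le_of_sum ?_ ?_
        · intro e'
          rw [this]
          split_ifs with h
          · rw [h]; exact hke
          · exact Nat.zero_le _
        · simp [this, hsum]
    · have hcnt : cnt b c k = ∑ e, k e := by simp [cnt, hcb]
      by_cases hs1 : ∑ e, k e = 1
      · obtain ⟨e, -, he⟩ := Finset.exists_ne_zero_of_sum_ne_zero h0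
        obtain ⟨heF, u, hu, hr⟩ := h1 e he
        obtain ⟨x, hx⟩ := Pt.exists_vert heF hu hr
        refine ⟨(x, none), ⟨hx.reach, fun h => absurd h hcb, by simp⟩, ?_⟩
        have : ∀ e', ext ends F b c (x, none) e' = if e' = e then 1 else 0 := by
          intro e'
          simp [ext, pt_ite hF hx]
        refine eq_of_le_of_sum ?_ ?_
        · intro e'
          rw [this]
          split_ifs with h
          · rw [h]; omega
          · exact Nat.zero_le _
        · simp [this, hs1]
      · have hs2 : ∑ e, k e = 2 := by omega
        obtain ⟨x, y, e, f, hx, he, hf, hke, hkf, hef, hs⟩ := (h3 (by omega)).2 hcb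
        have main : ∀ x y e f, Reachable ends F c x → Pt ends F x y e → Pt ends F y x f →
            1 ≤ k e → 1 ≤ k f → (e = f → k e = 2) → sd x = true → sd y = false →
            ∃ p, VOK ends F b sd c p ∧ ext ends F b c p = k := by
          intro x y e f hx he hf hke hkf hef hsx hsy
          have hy : Reachable ends F y c := reach_trans hf.reach (reach_symm hx)
          refine ⟨(y, some x), ⟨hy, fun h => absurd h hcb, ?_⟩, ?_⟩
          · intro a ha
            obtain rfl : x = a := by simpa using ha
            exact ⟨reach_symm hx, hsx, hsy⟩
          · have hyb : y ≠ b := by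
              rintro rfl
              exact hcb (hc (reach_symm hy))
            have : ∀ e', ext ends F b c (y, some x) e' =
                (if e' = e then 1 else 0) + (if e' = f then 1 else 0) := by
              intro e'
              simp [ext, pt_ite hF he, pt_ite hF hf, hyb]
            refine eq_of_le_of_sum ?_ ?_
            · intro e'
              rw [this]
              by_cases A : e' = e
              · by_cases B : e' = f
                · have := hef (A.symm.trans B)
                  simp only [A, if_true]
                  split_ifs <;> omega
                · subst A
                  simp only [if_true, B, if_false]
                  omega
              · by_cases B : e' = f
                · subst B
                  simp only [if_true, A, if_false]
                  omega
                · simp [A, B]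
            · simp [this, hs2, Finset.sum_add_distrib]
        cases hsx : sd x with
        | true =>
          refine main x y e f hx he hf hke hkf hef hsx ?_
          rw [hsx] at hs
          cases hsy : sd y <;> simp_all
        | false =>
          refine main y x f e (reach_trans hx he.reach) hf he hkf hke ?_ ?_ hsx
          · rintro rfl; exact hef rfl
          · rw [hsx] at hs
            cases hsy : sd y <;> simp_all

/-- The local bijection. -/
def locEquiv (hF : IsAcyclic ends F) (hb : sd b = false) (hc : Reachable ends F c b → c = b) :
    {p // VOK ends F b sd c p} ≃ {k // MOK ends F b sd c k} :=
  Equiv.ofBijective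
    (fun p => ⟨ext ends F b c p.1, by
      obtain ⟨⟨x, o⟩, hp⟩ := p
      cases o with
      | none => exact (ext_none hF hp).1
      | some a => exact (ext_some hF hb hc hp).1⟩)
    (by
      constructor
      · intro p q h
        exact Subtype.ext (ext_inj hF hb hc p.2 q.2 (congrArg Subtype.val h))
      · intro k
        obtain ⟨p, hp, he⟩ := ext_surj hF hb hc k.2
        exact ⟨⟨p, hp⟩, Subtype.ext he⟩)

lemma locEquiv_two (hF : IsAcyclic ends F) (hb : sd b = false)
    (hc : Reachable ends F c b → c = b) (p : {p // VOK ends F b sd c p}) :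
    p.1.2 ≠ none ↔ cnt b c (locEquiv hF hb hc p).1 = 2 := by
  change p.1.2 ≠ none ↔ cnt b c (ext ends F b c p.1) = 2
  obtain ⟨⟨x, o⟩, hp⟩ := p
  cases o with
  | none =>
    have := (ext_none hF hp).2
    simp only [ne_eq, not_true_eq_false, false_iff]
    omega
  | some a => simpa using (ext_some hF hb hc hp).2

end Local

/-! ### Component representatives -/

section Reps

variable {ε ν : Type}

/-- A representative of the component of `v`, equal to `b` on the component of `b`. -/
def rep (ends : ε → Sym2 ν) (F : Finset ε) (b v : ν) : ν :=
  if Reachable ends F v b then b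
  else @Classical.epsilon ν ⟨b⟩ (fun w => Reachable ends F v w)

variable {ends : ε → Sym2 ν} {F : Finset ε} {b : ν}

lemma rep_reach (v : ν) : Reachable ends F v (rep ends F b v) := by
  unfold rep
  split_ifs with h
  · exact h
  · exact Classical.epsilon_spec (p := fun w => Reachable ends F v w) ⟨v, reach_refl F v⟩

lemma rep_eq {u v : ν} (h : Reachable ends F u v) : rep ends F b u = rep ends F b v := by
  have : (fun w => Reachable ends F u w) = (fun w => Reachable ends F v w) := by
    funext w
    exact propext ⟨fun h' => reach_trans (reach_symm h) h', fun h' => reach_trans h h'⟩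
  unfold rep
  rw [congrFun this b, this]

lemma rep_b : rep ends F b b = b := by
  unfold rep
  rw [if_pos (reach_refl F b)]

/-- The type of component representatives. -/
abbrev Reps (ends : ε → Sym2 ν) (F : Finset ε) (b : ν) := {c : ν // rep ends F b c = c}

/-- The representative of `v` as an element of `Reps`. -/
def mkRep (ends : ε → Sym2 ν) (F : Finset ε) (b v : ν) : Reps ends F b :=
  ⟨rep ends F b v, (rep_eq (rep_reach v)).symm⟩

lemma Reps.eq_of_reach {c c' : Reps ends F b} (h : Reachable ends F c.1 c'.1) : c = c' :=
  Subtype.ext (by rw [← c.2, ← c'.2, rep_eq h])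

lemma Reps.eq_b {c : Reps ends F b} (h : Reachable ends F c.1 b) : c.1 = b := by
  rw [← c.2, rep_eq h, rep_b]

end Reps

namespace BiconedGraph

variable (P : BiconedGraph)

/-- The edge roots of `mult` in the component of `c`. -/
def locM (F : Finset P.Ered) (mult : P.Ered → ℕ) (c : P.Vred) (e : P.Ered) : ℕ :=
  if e ∈ F ∧ P.Touches F c e then mult e - 1 else 0

variable {P}

lemma side_bot : P.side ⊥ = false := rfl
lemma side_a (a : Fin P.m) : P.side (P.liftV (P.aVert a)) = true := rfl
lemma side_b (b : Fin P.n) : P.side (P.liftV (P.bVert b)) = false := rfl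

lemma touches_congr {F : Finset P.Ered} {u v : P.Vred} (h : Reachable P.endsRed F u v)
    (e : P.Ered) : P.Touches F u e ↔ P.Touches F v e :=
  ⟨fun ⟨w, h1, h2⟩ => ⟨w, h1, reach_trans (reach_symm h) h2⟩,
   fun ⟨w, h1, h2⟩ => ⟨w, h1, reach_trans h h2⟩⟩

lemma locM_congr {F : Finset P.Ered} {mult : P.Ered → ℕ} {u v : P.Vred}
    (h : Reachable P.endsRed F u v) : P.locM F mult u = P.locM F mult v := by
  funext e
  simp only [locM, touches_congr h]

lemma reach_bot_iff {F : Finset P.Ered} (v : P.Vred) :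
    Reachable P.endsRed F v ⊥ ↔ rep P.endsRed F ⊥ v = ⊥ :=
  ⟨fun h => by rw [rep_eq h, rep_b], fun h => by
    have := rep_reach (ends := P.endsRed) (F := F) (b := ⊥) v
    rwa [h] at this⟩

lemma compCount_eq {F : Finset P.Ered} {mult : P.Ered → ℕ} (hm : P.mSupport mult = F)
    (v : P.Vred) :
    P.compCount mult v = cnt (⊥ : P.Vred) (rep P.endsRed F ⊥ v) (P.locM F mult v) := by
  unfold compCount compEdgeRoots cnt
  rw [hm]
  congr 1
  · rw [← Finset.sum_filter, ← Finset.sum_filter_add_sum_filter_not Finset.univ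
      (fun e => e ∈ F ∧ P.Touches F v e)]
    rw [Finset.sum_eq_zero (s := Finset.univ.filter fun e => ¬ (e ∈ F ∧ P.Touches F v e)), add_zero]
    · refine Finset.sum_congr ?_ ?_
      · ext e; simp
      · intro e he
        have := (Finset.mem_filter.1 he).2
        simp [locM, this]
    · intro e he
      have := (Finset.mem_filter.1 he).2
      simp only [locM, this, if_false]
  · simp only [reach_bot_iff]
    split_ifs <;> rfl

lemma locM_pos {F : Finset P.Ered} {mult : P.Ered → ℕ} {c : P.Vred} {e : P.Ered}
    (h : 1 ≤ P.locM F mult c e) : P.locM F mult c e = mult e - 1 ∧ 2 ≤ mult e := by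
  unfold locM at h ⊢
  split_ifs at h ⊢ with h1
  · exact ⟨rfl, by omega⟩
  · omega

lemma c3_iff {F : Finset P.Ered} {mult : P.Ered → ℕ} (hm : P.mSupport mult = F)
    (hF : IsAcyclic P.endsRed F) (v : P.Vred) :
    P.C3At mult v ↔ C3loc P.endsRed F ⊥ P.side (rep P.endsRed F ⊥ v) (P.locM F mult v) := by
  unfold C3At C3loc
  rw [hm]
  simp only [reach_bot_iff, ne_eq]
  have hlv : ∀ x y e, Reachable P.endsRed F v x → Pt P.endsRed F x y e →
      P.locM F mult v e = mult e - 1 := by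
    intro x y e hr h
    have ht : e ∈ F ∧ P.Touches F v e := h.mem_touch (reach_symm hr)
    simp [locM, ht]
  refine and_congr (imp_congr_right fun hv => ?_) (imp_congr_right fun hv => ?_)
  · rw [← reach_bot_iff] at hv
    constructor
    · rintro ⟨x, p, h1, h2, ⟨e, h3, h4⟩, h5⟩
      have hp := path_last_pt p h1 h2 h3
      refine ⟨x, e, hp, ?_, ?_⟩
      · rw [hlv x _ e (reach_trans hv (reach_symm hp.reach)) hp]
        omega
      · have := (odd_bridge _ p).1 h5
        rw [side_bot] at this
        cases hx : P.side x <;> simp_all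
    · rintro ⟨x, e, h1, h2, h3⟩
      obtain ⟨f, hf⟩ := Pt.exists_edge (reach_symm h1.reach) (h1.ne hF).symm
      obtain ⟨p, p1, p2, p3, p4, p5⟩ := (exists_path_iff hF P.side ⊥ x f e).2
        ⟨hf, h1, by rw [h3, side_bot]; simp⟩
      exact ⟨x, p, p1, p2, ⟨e, p4, (locM_pos h2).2⟩, p5⟩
  · constructor
    · rintro ⟨x, y, p, h1, h2, hr, ⟨e, h3, h4⟩, ⟨f, h5, h6⟩, h7, h8⟩
      have hp1 := path_head_pt p h1 h2 h3
      have hp2 := path_last_pt p h1 h2 h5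
      have hry := reach_trans hr hp1.reach
      refine ⟨x, y, e, f, reach_trans (reach_symm (rep_reach v)) hr, hp1, hp2, ?_, ?_, ?_,
        (odd_bridge _ p).1 h8⟩
      · rw [hlv x y e hr hp1]; omega
      · rw [hlv y x f hry hp2]; omega
      · rintro rfl
        rw [hlv x y e hr hp1, h7 e ?_]
        cases p with
        | nil => simp [MWalk.edges] at h3
        | cons g w hw q =>
          simp only [MWalk.edges, List.head?_cons, Option.some.injEq] at h3
          subst h3
          cases hq : q.edges with
          | nil => simp [MWalk.edges, hq]
          | cons g' l =>
            exfalso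
            simp only [MWalk.IsPath, MWalk.support, List.nodup_cons] at h1
            have h5' : q.edges.getLast? = some g := by
              rw [hq]
              simpa [MWalk.edges, hq, List.getLast?_cons_cons] using h5
            exact h1.1 (mem_support_of_edge q (List.mem_of_getLast? h5') hw)
    · rintro ⟨x, y, e, f, hr, h1, h2, h3, h4, h5, h6⟩
      obtain ⟨p, p1, p2, p3, p4, p5⟩ := (exists_path_iff hF P.side x y e f).2 ⟨h1, h2, h6⟩
      refine ⟨x, y, p, p1, p2, reach_trans (rep_reach v) hr, ⟨e, p3, (locM_pos h3).2⟩,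
        ⟨f, p4, (locM_pos h4).2⟩, ?_, p5⟩
      intro g hg
      rw [hg] at p3 p4
      simp only [List.head?_cons, List.getLast?_singleton, Option.some.injEq] at p3 p4
      subst p3
      subst p4
      have := h5 rfl
      have := (locM_pos h3).1
      omega

lemma is2ERF_iff {F : Finset P.Ered} {mult : P.Ered → ℕ} (hm : P.mSupport mult = F)
    (hF : IsAcyclic P.endsRed F) :
    P.Is2ERF mult ↔
      (∀ c : Reps P.endsRed F ⊥, MOK P.endsRed F ⊥ P.side c.1 (P.locM F mult c.1)) ∧
      (∀ c c' : Reps P.endsRed F ⊥, cnt ⊥ c.1 (P.locM F mult c.1) = 2 →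
        cnt ⊥ c'.1 (P.locM F mult c'.1) = 2 → c = c') := by
  have hcc : ∀ c : Reps P.endsRed F ⊥,
      P.compCount mult c.1 = cnt ⊥ c.1 (P.locM F mult c.1) := by
    intro c
    rw [compCount_eq hm, c.2]
  have hcv : ∀ v, P.compCount mult v =
      cnt ⊥ (mkRep P.endsRed F ⊥ v).1 (P.locM F mult (mkRep P.endsRed F ⊥ v).1) := by
    intro v
    rw [compCount_eq hm, locM_congr (rep_reach (b := ⊥) v)]
    rfl
  unfold Is2ERF
  rw [hm]
  constructor
  · rintro ⟨-, h1, h2, h3⟩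
    refine ⟨fun c => ⟨?_, ?_, ?_⟩, ?_⟩
    · intro e he
      unfold locM at he
      by_contra hno
      exact he (if_neg hno)
    · rw [← hcc]; exact h1 _
    · intro h
      rw [← hcc] at h
      have := (c3_iff hm hF c.1).1 (h3 _ h)
      rwa [c.2] at this
    · intro c c' hc hc'
      rw [← hcc] at hc hc'
      exact Reps.eq_of_reach (h2 _ _ hc hc')
  · rintro ⟨h1, h2⟩
    refine ⟨hF, ?_, ?_, ?_⟩
    · intro v
      rw [hcv]
      exact (h1 _).2.1
    · intro u v hu hv
      rw [hcv] at hu hv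
      have h3 : rep P.endsRed F ⊥ u = rep P.endsRed F ⊥ v := congrArg Subtype.val (h2 _ _ hu hv)
      have h4 := rep_reach (ends := P.endsRed) (F := F) (b := ⊥) u
      rw [h3] at h4
      exact reach_trans h4 (reach_symm (rep_reach v))
    · intro v hv
      rw [hcv] at hv
      rw [c3_iff hm hF, locM_congr (rep_reach (b := ⊥) v)]
      exact (h1 (mkRep P.endsRed F ⊥ v)).2.2 hv

variable (P) in
/-- Families of local edge configurations. -/
abbrev MFam (F : Finset P.Ered) :=
  {h : (∀ c : Reps P.endsRed F ⊥, {k // MOK P.endsRed F ⊥ P.side c.1 k}) //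
    ∀ c c', cnt ⊥ c.1 (h c).1 = 2 → cnt ⊥ c'.1 (h c').1 = 2 → c = c'}

/-- The representative of the component of an edge. -/
def repE (F : Finset P.Ered) (e : P.Ered) : Reps P.endsRed F ⊥ :=
  mkRep P.endsRed F ⊥ (Quot.out (P.endsRed e)).1

lemma repE_touches (F : Finset P.Ered) (e : P.Ered) : P.Touches F (repE F e).1 e :=
  ⟨_, Sym2.out_fst_mem _, reach_symm (rep_reach _)⟩

lemma repE_unique {F : Finset P.Ered} {e : P.Ered} (he : e ∈ F) {c : Reps P.endsRed F ⊥}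
    (h : P.Touches F c.1 e) : c = repE F e := by
  obtain ⟨u, hu, hr⟩ := h
  obtain ⟨w, hw, hr'⟩ := repE_touches F e
  refine Reps.eq_of_reach (reach_trans hr (reach_trans ?_ (reach_symm hr')))
  obtain ⟨z, hz⟩ := Sym2.mem_iff_exists.1 hu
  rw [hz, Sym2.mem_iff] at hw
  rcases hw with rfl | rfl
  · exact reach_refl _ _
  · exact reach_edge he hz

/-- Step D: 2-edge-rooted forests are families of local edge configurations. -/
def multEquiv {F : Finset P.Ered} (hF : IsAcyclic P.endsRed F) :
    {mult : P.Ered → ℕ // P.Is2ERF mult ∧ P.mSupport mult = F} ≃ P.MFam F :=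
  Equiv.ofBijective
    (fun mult => ⟨fun c => ⟨P.locM F mult.1 c.1,
      ((is2ERF_iff mult.2.2 hF).1 mult.2.1).1 c⟩,
      ((is2ERF_iff mult.2.2 hF).1 mult.2.1).2⟩)
    (by
      constructor
      · rintro ⟨m1, h1, hs1⟩ ⟨m2, h2, hs2⟩ h
        refine Subtype.ext (funext fun e => ?_)
        have hc := congrArg (fun z => (z.1 (repE F e)).1 e) h
        simp only at hc
        have e1 : e ∈ F ↔ m1 e ≠ 0 := by rw [← hs1]; simp [mSupport]
        have e2 : e ∈ F ↔ m2 e ≠ 0 := by rw [← hs2]; simp [mSupport]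
        simp only
        by_cases he : e ∈ F
        · simp only [locM, he, repE_touches, true_and, if_true] at hc
          have := e1.1 he
          have := e2.1 he
          omega
        · have a1 : m1 e = 0 := by_contra fun hh => he (e1.2 hh)
          have a2 : m2 e = 0 := by_contra fun hh => he (e2.2 hh)
          rw [a1, a2]
      · rintro ⟨h, hu⟩
        let mult : P.Ered → ℕ := fun e => if e ∈ F then 1 + (h (repE F e)).1 e else 0
        have hs : P.mSupport mult = F := by
          ext e
          by_cases he : e ∈ F <;> simp [mSupport, mult, he]
        have hl : ∀ c : Reps P.endsRed F ⊥, P.locM F mult c.1 = (h c).1 := by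
          intro c
          funext e
          unfold locM
          by_cases ht : e ∈ F ∧ P.Touches F c.1 e
          · rw [if_pos ht]
            have hc := repE_unique ht.1 ht.2
            subst hc
            simp only [mult, ht.1, if_true]
            omega
          · rw [if_neg ht]
            by_contra hne
            exact ht ((h c).2.1 e (Ne.symm hne))
        refine ⟨⟨mult, (is2ERF_iff hs hF).2 ⟨?_, ?_⟩, hs⟩, ?_⟩
        · intro c; rw [hl]; exact (h c).2
        · intro c c'; rw [hl, hl]; exact hu c c'
        · refine Subtype.ext (funext fun c => Subtype.ext ?_)
          exact hl c)

variable (P) in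
/-- Families of local vertex configurations. -/
abbrev VFam (F : Finset P.Ered) :=
  {g : (∀ c : Reps P.endsRed F ⊥, {p // VOK P.endsRed F ⊥ P.side c.1 p}) //
    ∀ c c', (g c).1.2 ≠ none → (g c').1.2 ≠ none → c = c'}

/-- Step C: gluing the local bijections. -/
def famEquiv {F : Finset P.Ered} (hF : IsAcyclic P.endsRed F) : P.VFam F ≃ P.MFam F :=
  Equiv.subtypeEquiv
    (Equiv.piCongrRight fun c => locEquiv hF side_bot (fun h => Reps.eq_b h))
    (by
      intro g
      refine forall_congr' fun c => forall_congr' fun c' => ?_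
      exact imp_congr (locEquiv_two hF side_bot (fun h => Reps.eq_b h) (g c))
        (imp_congr (locEquiv_two hF side_bot (fun h => Reps.eq_b h) (g c')) Iff.rfl))

end BiconedGraph

/-! ### Spanning trees -/

namespace BiconedGraph

variable {P : BiconedGraph}

lemma vred_cases (v : P.Vred) :
    v = ⊥ ∨ (∃ a, v = P.liftV (P.aVert a)) ∨ (∃ b, v = P.liftV (P.bVert b)) := by
  induction v using WithBot.recBotCoe with
  | bot => exact Or.inl rfl
  | coe x =>
    right
    rcases x with a | b
    · exact Or.inl ⟨a, rfl⟩
    · exact Or.inr ⟨b, rfl⟩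

lemma liftV_a_ne_bot (a : Fin P.m) : P.liftV (P.aVert a) ≠ ⊥ := WithBot.coe_ne_bot
lemma liftV_b_ne_bot (b : Fin P.n) : P.liftV (P.bVert b) ≠ ⊥ := WithBot.coe_ne_bot
lemma liftV_a_inj {a a' : Fin P.m} (h : P.liftV (P.aVert a) = P.liftV (P.aVert a')) : a = a' := by
  have := WithBot.coe_injective h
  exact Sum.inl_injective this
lemma liftV_b_inj {a a' : Fin P.n} (h : P.liftV (P.bVert a) = P.liftV (P.bVert a')) : a = a' := by
  have := WithBot.coe_injective h
  exact Sum.inr_injective this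
lemma liftV_a_ne_b (a : Fin P.m) (b : Fin P.n) : P.liftV (P.aVert a) ≠ P.liftV (P.bVert b) := by
  intro h
  have := congrArg P.side h
  rw [side_a, side_b] at this
  cases this

lemma endsB_red {e : P.Ered} {u v : P.Vred} (h : P.endsRed e = s(u, v)) :
    P.endsB (P.redToEB e) = s(P.liftW u, P.liftW v) := by
  have : P.endsB (P.redToEB e) = (P.endsRed e).map P.liftW := by
    rcases e with a | e
    · rfl
    · change (P.ends e).map _ = ((P.ends e).map P.liftV).map P.liftW
      rw [Sym2.map_map]
      rfl
  rw [this, h]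
  rfl

lemma redToEB_inj {e f : P.Ered} (h : P.redToEB e = P.redToEB f) : e = f := by
  rcases e with e | e <;> rcases f with f | f <;> simp_all [redToEB]

lemma EB_cases (g : P.EB) : g = P.e00 ∨ (∃ a, g = P.eA a) ∨ (∃ b, g = P.eB b) ∨
    (∃ e, g = P.redToEB e) := by
  rcases g with _ | a | b | s | e
  · exact Or.inl rfl
  · exact Or.inr (Or.inl ⟨a, rfl⟩)
  · exact Or.inr (Or.inr (Or.inl ⟨b, rfl⟩))
  · exact Or.inr (Or.inr (Or.inr ⟨Sum.inl s, rfl⟩))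
  · exact Or.inr (Or.inr (Or.inr ⟨Sum.inr e, rfl⟩))

lemma mem_redOf {T : Finset P.EB} {e : P.Ered} : e ∈ P.redOf T ↔ P.redToEB e ∈ T := by
  simp [redOf]

/-- The predicate on the vertices of `G^{A,B}` given by its value at `0` and on the rest. -/
def cutX (z : Prop) (Y : P.Vred → Prop) : P.W → Prop := WithBot.recBotCoe z Y

lemma iff_of_ends {ε ν : Type} {ends : ε → Sym2 ν} {X : ν → Prop} {e : ε} {p q x y : ν}
    (h : ends e = s(p, q)) (hX : X p ↔ X q) (h' : ends e = s(x, y)) : X x ↔ X y := by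
  rw [h, Sym2.eq_iff] at h'
  rcases h' with ⟨rfl, rfl⟩ | ⟨rfl, rfl⟩
  · exact hX
  · exact hX.symm

lemma cut_inv {T : Finset P.EB} {z : Prop} {Y : P.Vred → Prop}
    (h0 : P.e00 ∈ T → (z ↔ Y ⊥))
    (hA : ∀ a, P.eA a ∈ T → (z ↔ Y (P.liftV (P.aVert a))))
    (hB : ∀ b, P.eB b ∈ T → (Y ⊥ ↔ Y (P.liftV (P.bVert b))))
    (hR : ∀ e, P.redToEB e ∈ T → ∀ u v, P.endsRed e = s(u, v) → (Y u ↔ Y v))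
    {x y : P.W} (hr : Reachable P.endsB T x y) : cutX z Y x ↔ cutX z Y y := by
  have key : ∀ g ∈ T, ∀ x y, P.endsB g = s(x, y) → (cutX z Y x ↔ cutX z Y y) := by
    intro g hg x y hxy
    rcases EB_cases g with rfl | ⟨a, rfl⟩ | ⟨b, rfl⟩ | ⟨e, rfl⟩
    · exact iff_of_ends (X := cutX z Y) (p := ⊥) (q := P.liftW ⊥) rfl (h0 hg) hxy
    · exact iff_of_ends (X := cutX z Y) (p := ⊥) (q := P.liftW (P.liftV (P.aVert a)))
        rfl (hA a hg) hxy
    · exact iff_of_ends (X := cutX z Y) (p := P.liftW ⊥) (q := P.liftW (P.liftV (P.bVert b)))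
        rfl (hB b hg) hxy
    · obtain ⟨⟨u, v⟩, huv⟩ := Quot.exists_rep (P.endsRed e)
      exact iff_of_ends (X := cutX z Y) (endsB_red huv.symm) (hR e hg u v huv.symm) hxy
  constructor
  · exact fun h => reach_inv (fun g hg a b hab => (key g hg a b hab).1) hr h
  · exact fun h => reach_inv (fun g hg a b hab => (key g hg a b hab).1) (reach_symm hr) h

lemma reach_lift {F : Finset P.Ered} {T : Finset P.EB} (h : ∀ e ∈ F, P.redToEB e ∈ T)
    {u v : P.Vred} (hr : Reachable P.endsRed F u v) :
    Reachable P.endsB T (P.liftW u) (P.liftW v) :=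
  reach_of_edges P.liftW (fun e he _ _ huv => reach_edge (h e he) (endsB_red huv)) hr

variable (P) in
/-- Good root data. -/
structure Good (F : Finset P.Ered) (R O : Set P.Vred) : Prop where
  bot : ⊥ ∈ R
  ex : ∀ v, ∃ r ∈ R, Reachable P.endsRed F v r
  un : ∀ r ∈ R, ∀ r' ∈ R, Reachable P.endsRed F r r' → r = r'
  sub : ∀ a ∈ O, ∀ a' ∈ O, a = a'
  sd : ∀ a ∈ O, P.side a = true ∧ ∀ r ∈ R, Reachable P.endsRed F a r → P.side r = false

variable (P) in
/-- The edge set encoded by root data. -/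
def tr (F : Finset P.Ered) (R O : Set P.Vred) : Finset P.EB :=
  Finset.univ.filter fun e => match e with
    | Sum.inl _ => O = ∅
    | Sum.inr (Sum.inl a) => P.liftV (P.aVert a) ∈ R ∨ P.liftV (P.aVert a) ∈ O
    | Sum.inr (Sum.inr (Sum.inl b)) => P.liftV (P.bVert b) ∈ R
    | Sum.inr (Sum.inr (Sum.inr e)) => e ∈ F

lemma mem_tr_e00 {F : Finset P.Ered} {R O : Set P.Vred} : P.e00 ∈ P.tr F R O ↔ O = ∅ := by
  simp [tr]
lemma mem_tr_eA {F : Finset P.Ered} {R O : Set P.Vred} {a : Fin P.m} :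
    P.eA a ∈ P.tr F R O ↔ P.liftV (P.aVert a) ∈ R ∨ P.liftV (P.aVert a) ∈ O := by
  simp [tr]
lemma mem_tr_eB {F : Finset P.Ered} {R O : Set P.Vred} {b : Fin P.n} :
    P.eB b ∈ P.tr F R O ↔ P.liftV (P.bVert b) ∈ R := by
  simp [tr]
lemma mem_tr_red {F : Finset P.Ered} {R O : Set P.Vred} {e : P.Ered} :
    P.redToEB e ∈ P.tr F R O ↔ e ∈ F := by
  rcases e with e | e <;> simp [tr, redToEB]

lemma redOf_tr (F : Finset P.Ered) (R O : Set P.Vred) : P.redOf (P.tr F R O) = F := by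
  ext e
  rw [mem_redOf, mem_tr_red]

lemma EB_ext {T T' : Finset P.EB} (h0 : P.e00 ∈ T ↔ P.e00 ∈ T')
    (hA : ∀ a, P.eA a ∈ T ↔ P.eA a ∈ T') (hB : ∀ b, P.eB b ∈ T ↔ P.eB b ∈ T')
    (hR : ∀ e, P.redToEB e ∈ T ↔ P.redToEB e ∈ T') : T = T' := by
  ext g
  rcases EB_cases g with rfl | ⟨a, rfl⟩ | ⟨b, rfl⟩ | ⟨e, rfl⟩
  · exact h0
  · exact hA a
  · exact hB b
  · exact hR e

lemma e00_ne_red (e : P.Ered) : P.e00 ≠ P.redToEB e := by rcases e with e | e <;> simp [redToEB]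
lemma eA_ne_red (a) (e : P.Ered) : P.eA a ≠ P.redToEB e := by
  rcases e with e | e <;> simp [redToEB]
lemma eB_ne_red (b) (e : P.Ered) : P.eB b ≠ P.redToEB e := by
  rcases e with e | e <;> simp [redToEB]

/-- A cut certificate for acyclicity. -/
lemma not_reach_of_cut {T : Finset P.EB} {z : Prop} {Y : P.Vred → Prop} {f : P.EB} {p q : P.W}
    (hf : P.endsB f = s(p, q)) (hpq : ¬ (cutX z Y p ↔ cutX z Y q))
    (h0 : P.e00 ∈ T → P.e00 ≠ f → (z ↔ Y ⊥))
    (hA : ∀ a, P.eA a ∈ T → P.eA a ≠ f → (z ↔ Y (P.liftV (P.aVert a))))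
    (hB : ∀ b, P.eB b ∈ T → P.eB b ≠ f → (Y ⊥ ↔ Y (P.liftV (P.bVert b))))
    (hR : ∀ e, P.redToEB e ∈ T → P.redToEB e ≠ f →
      ∀ u v, P.endsRed e = s(u, v) → (Y u ↔ Y v))
    {x y : P.W} (hxy : P.endsB f = s(x, y)) : ¬ Reachable P.endsB (T.erase f) x y := by
  intro hr
  apply hpq
  have h := cut_inv (z := z) (Y := Y) (T := T.erase f)
    (fun h => h0 (Finset.mem_of_mem_erase h) (Finset.ne_of_mem_erase h))
    (fun a h => hA a (Finset.mem_of_mem_erase h) (Finset.ne_of_mem_erase h))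
    (fun b h => hB b (Finset.mem_of_mem_erase h) (Finset.ne_of_mem_erase h))
    (fun e h => hR e (Finset.mem_of_mem_erase h) (Finset.ne_of_mem_erase h)) hr
  exact iff_of_ends (X := cutX z Y) hxy h hf

lemma tr_none_tree {F : Finset P.Ered} (hF : IsAcyclic P.endsRed F) {R : Set P.Vred}
    (hG : P.Good F R ∅) : IsSpanningTree P.endsB (P.tr F R ∅) := by
  have h00 : P.e00 ∈ P.tr F R ∅ := mem_tr_e00.2 rfl
  have hAm : ∀ {a}, P.eA a ∈ P.tr F R ∅ → P.liftV (P.aVert a) ∈ R := by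
    intro a ha
    simpa using mem_tr_eA.1 ha
  have hBm : ∀ {b}, P.eB b ∈ P.tr F R ∅ → P.liftV (P.bVert b) ∈ R := fun hb => mem_tr_eB.1 hb
  have hFadj : ∀ e, P.redToEB e ∈ P.tr F R ∅ → ∀ u v, P.endsRed e = s(u, v) → ∀ w,
      (Reachable P.endsRed F u w ↔ Reachable P.endsRed F v w) := by
    intro e he u v huv w
    have := reach_edge (mem_tr_red.1 he) huv
    exact ⟨fun h => reach_trans (reach_symm this) h, fun h => reach_trans this h⟩
  constructor
  · intro f hf x y hxy
    rcases EB_cases f with rfl | ⟨a, rfl⟩ | ⟨b, rfl⟩ | ⟨e, rfl⟩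
    · refine not_reach_of_cut (z := True)
        (Y := fun v => ∃ r ∈ R, P.side r = true ∧ Reachable P.endsRed F v r)
        (p := ⊥) (q := P.liftW ⊥) rfl ?_ ?_ ?_ ?_ ?_ hxy
      · change ¬ (True ↔ ∃ r ∈ R, P.side r = true ∧ Reachable P.endsRed F ⊥ r)
        rintro h
        obtain ⟨r, hr, hs, hre⟩ := h.1 trivial
        rw [← hG.un _ hG.bot r hr hre, side_bot] at hs
        cases hs
      · intro _ h; exact absurd rfl h
      · intro a ha _
        exact iff_of_true trivial ⟨_, hAm ha, side_a a, reach_refl _ _⟩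
      · intro b hb _
        refine iff_of_false ?_ ?_
        · rintro ⟨r, hr, hs, hre⟩
          rw [← hG.un _ hG.bot r hr hre, side_bot] at hs
          cases hs
        · rintro ⟨r, hr, hs, hre⟩
          rw [← hG.un _ (hBm hb) r hr hre, side_b] at hs
          cases hs
      · intro e he _ u v huv
        refine exists_congr fun r => and_congr_right fun _ => and_congr_right fun _ => ?_
        exact hFadj e he u v huv r
    · have haR := hAm hf
      refine not_reach_of_cut (z := False)
        (Y := fun v => Reachable P.endsRed F v (P.liftV (P.aVert a)))
        (p := ⊥) (q := P.liftW (P.liftV (P.aVert a))) rfl ?_ ?_ ?_ ?_ ?_ hxy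
      · change ¬ (False ↔ Reachable P.endsRed F _ _)
        exact fun h => h.2 (reach_refl _ _)
      · intro _ _
        exact iff_of_false id fun h => liftV_a_ne_bot a (hG.un _ hG.bot _ haR h).symm
      · intro a' ha' hne
        refine iff_of_false id fun h => hne ?_
        rw [liftV_a_inj (hG.un _ (hAm ha') _ haR h)]
      · intro b hb _
        exact iff_of_false (fun h => liftV_a_ne_bot a (hG.un _ hG.bot _ haR h).symm)
          (fun h => liftV_a_ne_b a b (hG.un _ (hBm hb) _ haR h).symm)
      · intro e he _ u v huv
        exact hFadj e he u v huv _
    · have haR := hBm hf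
      refine not_reach_of_cut (z := False)
        (Y := fun v => Reachable P.endsRed F v (P.liftV (P.bVert b)))
        (p := P.liftW ⊥) (q := P.liftW (P.liftV (P.bVert b))) rfl ?_ ?_ ?_ ?_ ?_ hxy
      · change ¬ (Reachable P.endsRed F _ _ ↔ Reachable P.endsRed F _ _)
        intro h
        exact liftV_b_ne_bot b (hG.un _ hG.bot _ haR (h.2 (reach_refl _ _))).symm
      · intro _ _
        exact iff_of_false id fun h => liftV_b_ne_bot b (hG.un _ hG.bot _ haR h).symm
      · intro a' ha' hne
        exact iff_of_false id fun h => liftV_a_ne_b a' b (hG.un _ (hAm ha') _ haR h)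
      · intro b' hb hne
        refine iff_of_false (fun h => liftV_b_ne_bot b (hG.un _ hG.bot _ haR h).symm)
          (fun h => hne ?_)
        rw [liftV_b_inj (hG.un _ (hBm hb) _ haR h)]
      · intro e he _ u v huv
        exact hFadj e he u v huv _
    · have heF := mem_tr_red.1 hf
      obtain ⟨⟨u0, v0⟩, huv0⟩ := Quot.exists_rep (P.endsRed e)
      have hu0 : u0 ∈ P.endsRed e := by rw [← huv0]; exact Sym2.mem_mk_left _ _
      obtain ⟨r, hr, hre⟩ := hG.ex u0
      obtain ⟨u, hu⟩ := Pt.exists_vert heF hu0 (reach_symm hre)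
      have hur := hu.reach
      obtain ⟨-, w, hw, hwr⟩ := hu
      have hno : ∀ r' ∈ R, ¬ Reachable P.endsRed (F.erase e) r' u := by
        intro r' hr' h
        have h1 := reach_trans (reach_mono (Finset.erase_subset _ _) h) hur
        have h2 := hG.un _ hr' _ hr h1
        subst h2
        exact hF e heF u w hw (reach_symm (reach_trans hwr h))
      refine not_reach_of_cut (z := False)
        (Y := fun v => Reachable P.endsRed (F.erase e) v u) (endsB_red hw) ?_ ?_ ?_ ?_ ?_ hxy
      · change ¬ (Reachable P.endsRed (F.erase e) _ _ ↔ Reachable P.endsRed (F.erase e) _ _)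
        intro h
        exact hF e heF u w hw (reach_symm (h.1 (reach_refl _ _)))
      · intro _ _
        exact iff_of_false id (hno _ hG.bot)
      · intro a ha _
        exact iff_of_false id (hno _ (hAm ha))
      · intro b hb _
        exact iff_of_false (hno _ hG.bot) (hno _ (hBm hb))
      · intro g hg hne x y hxy
        have hge : g ∈ F.erase e :=
          Finset.mem_erase.2 ⟨fun h => hne (by rw [h]), mem_tr_red.1 hg⟩
        have := reach_edge hge hxy
        exact ⟨fun h => reach_trans (reach_symm this) h, fun h => reach_trans this h⟩
  · have hbot : Reachable P.endsB (P.tr F R ∅) (P.liftW ⊥) ⊥ :=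
      reach_symm (reach_edge h00 rfl)
    have hto : ∀ x : P.W, Reachable P.endsB (P.tr F R ∅) x ⊥ := by
      intro x
      induction x using WithBot.recBotCoe with
      | bot => exact reach_refl _ _
      | coe v =>
        obtain ⟨r, hr, hre⟩ := hG.ex v
        have h1 : Reachable P.endsB (P.tr F R ∅) (P.liftW v) (P.liftW r) :=
          reach_lift (fun e he => mem_tr_red.2 he) hre
        refine reach_trans h1 ?_
        rcases vred_cases r with rfl | ⟨a, rfl⟩ | ⟨b, rfl⟩
        · exact hbot
        · exact reach_symm (reach_edge (e := P.eA a) (mem_tr_eA.2 (Or.inl hr)) rfl)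
        · exact reach_trans (reach_symm (reach_edge (e := P.eB b) (mem_tr_eB.2 hr) rfl)) hbot
    exact fun x y => reach_trans (hto x) (reach_symm (hto y))

lemma Good.none {F : Finset P.Ered} {R O : Set P.Vred} (h : P.Good F R O) : P.Good F R ∅ :=
  ⟨h.bot, h.ex, h.un, by simp, by simp⟩

lemma exists_a_of_side {v : P.Vred} (h : P.side v = true) : ∃ a, v = P.liftV (P.aVert a) := by
  rcases vred_cases v with rfl | ⟨a, rfl⟩ | ⟨b, rfl⟩
  · cases h
  · exact ⟨a, rfl⟩
  · cases h

lemma tr_tree {F : Finset P.Ered} (hF : IsAcyclic P.endsRed F) {R O : Set P.Vred}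
    (hG : P.Good F R O) : IsSpanningTree P.endsB (P.tr F R O) := by
  have hT := tr_none_tree hF hG.none
  by_cases hO : O = ∅
  · subst hO; exact hT
  · obtain ⟨v, hv⟩ := Set.nonempty_iff_ne_empty.2 hO
    obtain ⟨hs, hroot⟩ := hG.sd v hv
    obtain ⟨a, rfl⟩ := exists_a_of_side hs
    have heq : P.tr F R O = insert (P.eA a) ((P.tr F R ∅).erase P.e00) := by
      refine EB_ext ?_ ?_ ?_ ?_
      · rw [mem_tr_e00]
        simp [hO]
      · intro a'
        rw [Finset.mem_insert, Finset.mem_erase, mem_tr_eA, mem_tr_eA]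
        constructor
        · rintro (h | h)
          · exact Or.inr ⟨by simp, Or.inl h⟩
          · left
            rw [liftV_a_inj (hG.sub _ h _ hv)]
        · rintro (h | ⟨_, h | h⟩)
          · right
            have : a' = a := by simpa using h
            rw [this]; exact hv
          · exact Or.inl h
          · exact absurd h (by simp)
      · intro b
        rw [Finset.mem_insert, Finset.mem_erase, mem_tr_eB, mem_tr_eB]
        simp
      · intro e
        rw [Finset.mem_insert, Finset.mem_erase, mem_tr_red, mem_tr_red]
        have h1 := (eA_ne_red a e).symm
        have h2 := (e00_ne_red e).symm
        tauto
    rw [heq]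
    refine tree_exchange hT (u := ⊥) (v := P.liftW ⊥) (a := ⊥)
      (b := P.liftW (P.liftV (P.aVert a))) (mem_tr_e00.2 rfl) rfl rfl (reach_refl _ _) ?_
    obtain ⟨r, hr, hre⟩ := hG.ex (P.liftV (P.aVert a))
    have hsr := hroot r hr hre
    have h1 : Reachable P.endsB ((P.tr F R ∅).erase P.e00) (P.liftW (P.liftV (P.aVert a)))
        (P.liftW r) := reach_lift (fun e he => Finset.mem_erase.2
          ⟨(e00_ne_red e).symm, mem_tr_red.2 he⟩) hre
    refine reach_trans h1 ?_
    rcases vred_cases r with rfl | ⟨a', rfl⟩ | ⟨b, rfl⟩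
    · exact reach_refl _ _
    · cases hsr
    · exact reach_symm (reach_edge (e := P.eB b)
        (Finset.mem_erase.2 ⟨by simp, mem_tr_eB.2 hr⟩) rfl)

lemma tr_inj {F : Finset P.Ered} {R O R' O' : Set P.Vred}
    (hG : P.Good F R O) (hG' : P.Good F R' O') (h : P.tr F R O = P.tr F R' O') :
    R = R' ∧ O = O' := by
  have h0 : O = ∅ ↔ O' = ∅ := by
    rw [← mem_tr_e00 (F := F) (R := R), h, mem_tr_e00]
  have hA : ∀ a, (P.liftV (P.aVert a) ∈ R ∨ P.liftV (P.aVert a) ∈ O) ↔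
      (P.liftV (P.aVert a) ∈ R' ∨ P.liftV (P.aVert a) ∈ O') := by
    intro a
    rw [← mem_tr_eA (F := F) (R := R), h, mem_tr_eA]
  have hB : ∀ b, P.liftV (P.bVert b) ∈ R ↔ P.liftV (P.bVert b) ∈ R' := by
    intro b
    rw [← mem_tr_eB (F := F) (O := O), h, mem_tr_eB]
  have hOO : ∀ {R O R' O' : Set P.Vred}, P.Good F R O → P.Good F R' O' → (O = ∅ ↔ O' = ∅) →
      (∀ a, (P.liftV (P.aVert a) ∈ R ∨ P.liftV (P.aVert a) ∈ O) ↔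
      (P.liftV (P.aVert a) ∈ R' ∨ P.liftV (P.aVert a) ∈ O')) →
      (∀ b, P.liftV (P.bVert b) ∈ R ↔ P.liftV (P.bVert b) ∈ R') → O ⊆ O' := by
    intro R O R' O' hG hG' h0 hA hB v hv
    obtain ⟨hs, hroot⟩ := hG.sd v hv
    obtain ⟨a, rfl⟩ := exists_a_of_side hs
    rcases (hA a).1 (Or.inr hv) with hR | hO
    · exfalso
      obtain ⟨r, hr, hre⟩ := hG.ex (P.liftV (P.aVert a))
      have hsr := hroot r hr hre
      have hrR : r ∈ R' := by
        rcases vred_cases r with rfl | ⟨a', rfl⟩ | ⟨b, rfl⟩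
        · exact hG'.bot
        · cases hsr
        · exact (hB b).1 hr
      have := hG'.un _ hR _ hrR hre
      rw [← this, side_a] at hsr
      cases hsr
    · exact hO
  have hOeq : O = O' := Set.Subset.antisymm (hOO hG hG' h0 hA hB)
    (hOO hG' hG h0.symm (fun a => (hA a).symm) (fun b => (hB b).symm))
  refine ⟨?_, hOeq⟩
  subst hOeq
  have hdis : ∀ {R : Set P.Vred}, P.Good F R O → ∀ a, P.liftV (P.aVert a) ∈ O →
      P.liftV (P.aVert a) ∉ R := by
    intro R hG a ha hR
    have := (hG.sd _ ha).2 _ hR (reach_refl _ _)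
    rw [side_a] at this
    cases this
  ext v
  rcases vred_cases v with rfl | ⟨a, rfl⟩ | ⟨b, rfl⟩
  · exact iff_of_true hG.bot hG'.bot
  · have := hA a
    have h1 := hdis hG a
    have h2 := hdis hG' a
    tauto
  · exact hB b

lemma redOf_acyclic {T : Finset P.EB} (hT : IsAcyclic P.endsB T) :
    IsAcyclic P.endsRed (P.redOf T) := by
  intro e he u v huv hr
  refine hT _ (mem_redOf.1 he) _ _ (endsB_red huv) (reach_lift ?_ hr)
  intro f hf
  rw [Finset.mem_erase] at hf
  exact Finset.mem_erase.2 ⟨fun h => hf.1 (redToEB_inj h), mem_redOf.1 hf.2⟩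

/-- The roots of a tree. -/
def RT (T : Finset P.EB) : Set P.Vred :=
  {v | v = ⊥ ∨ (∃ a, v = P.liftV (P.aVert a) ∧ P.eA a ∈ T) ∨
    (∃ b, v = P.liftV (P.bVert b) ∧ P.eB b ∈ T)}

lemma mem_RT_a {T : Finset P.EB} {a} : P.liftV (P.aVert a) ∈ RT T ↔ P.eA a ∈ T := by
  constructor
  · rintro (h | ⟨a', h, h'⟩ | ⟨b, h, _⟩)
    · exact absurd h (liftV_a_ne_bot a)
    · rwa [liftV_a_inj h]
    · exact absurd h (liftV_a_ne_b a b)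
  · exact fun h => Or.inr (Or.inl ⟨a, rfl, h⟩)

lemma mem_RT_b {T : Finset P.EB} {b} : P.liftV (P.bVert b) ∈ RT T ↔ P.eB b ∈ T := by
  constructor
  · rintro (h | ⟨a, h, _⟩ | ⟨b', h, h'⟩)
    · exact absurd h (liftV_b_ne_bot b)
    · exact absurd h.symm (liftV_a_ne_b a b)
    · rwa [liftV_b_inj h]
  · exact fun h => Or.inr (Or.inr ⟨b, rfl, h⟩)

lemma good_of_tree {T : Finset P.EB} (hT : IsSpanningTree P.endsB T) (h00 : P.e00 ∈ T) :
    P.Good (P.redOf T) (RT T) ∅ ∧ P.tr (P.redOf T) (RT T) ∅ = T := by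
  refine ⟨⟨Or.inl rfl, ?_, ?_, by simp, by simp⟩, ?_⟩
  · intro v
    by_contra hno
    push Not at hno
    have h := cut_inv (T := T) (z := False) (Y := fun w => Reachable P.endsRed (P.redOf T) v w)
      (fun _ => iff_of_false id (hno _ (Or.inl rfl)))
      (fun a ha => iff_of_false id (hno _ (mem_RT_a.2 ha)))
      (fun b hb => iff_of_false (hno _ (Or.inl rfl)) (hno _ (mem_RT_b.2 hb)))
      (fun e he x y hxy => by
        have := reach_edge (mem_redOf.2 he) hxy
        exact ⟨fun h => reach_trans h this, fun h => reach_trans h (reach_symm this)⟩)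
      (hT.2 (P.liftW v) ⊥)
    exact h.1 (reach_refl _ _)
  · have main : ∀ r ∈ RT T, ∀ r' ∈ RT T, r ≠ ⊥ → Reachable P.endsRed (P.redOf T) r r' →
        r = r' := by
      intro r hr r' hr' hne hre
      by_contra hrr
      rcases vred_cases r with rfl | ⟨a, rfl⟩ | ⟨b, rfl⟩
      · exact hne rfl
      · refine hT.1 (P.eA a) (mem_RT_a.1 hr) (P.liftW (P.liftV (P.aVert a))) ⊥
          (Sym2.eq_swap) ?_
        have h1 : Reachable P.endsB (T.erase (P.eA a)) _ _ := reach_lift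
          (fun e he => Finset.mem_erase.2 ⟨(eA_ne_red a e).symm, mem_redOf.1 he⟩) hre
        have h2 : Reachable P.endsB (T.erase (P.eA a)) (P.liftW ⊥) ⊥ :=
          reach_symm (reach_edge (e := P.e00) (Finset.mem_erase.2 ⟨by simp, h00⟩) rfl)
        refine reach_trans h1 ?_
        rcases vred_cases r' with rfl | ⟨a', rfl⟩ | ⟨b, rfl⟩
        · exact h2
        · refine reach_symm (reach_edge (e := P.eA a') (Finset.mem_erase.2
            ⟨fun h => hrr ?_, mem_RT_a.1 hr'⟩) rfl)
          have : a' = a := by simpa using h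
          rw [this]
        · exact reach_trans (reach_symm (reach_edge (e := P.eB b) (Finset.mem_erase.2
            ⟨by simp, mem_RT_b.1 hr'⟩) rfl)) h2
      · refine hT.1 (P.eB b) (mem_RT_b.1 hr) (P.liftW (P.liftV (P.bVert b))) (P.liftW ⊥)
          (Sym2.eq_swap) ?_
        have h1 : Reachable P.endsB (T.erase (P.eB b)) _ _ := reach_lift
          (fun e he => Finset.mem_erase.2 ⟨(eB_ne_red b e).symm, mem_redOf.1 he⟩) hre
        have h2 : Reachable P.endsB (T.erase (P.eB b)) ⊥ (P.liftW ⊥) :=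
          reach_edge (e := P.e00) (Finset.mem_erase.2 ⟨by simp, h00⟩) rfl
        refine reach_trans h1 ?_
        rcases vred_cases r' with rfl | ⟨a', rfl⟩ | ⟨b', rfl⟩
        · exact reach_refl _ _
        · exact reach_trans (reach_symm (reach_edge (e := P.eA a') (Finset.mem_erase.2
            ⟨by simp, mem_RT_a.1 hr'⟩) rfl)) h2
        · refine reach_symm (reach_edge (e := P.eB b') (Finset.mem_erase.2
            ⟨fun h => hrr ?_, mem_RT_b.1 hr'⟩) rfl)
          have : b' = b := by simpa using h
          rw [this]
    intro r hr r' hr' hre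
    by_cases h : r = ⊥
    · by_cases h' : r' = ⊥
      · rw [h, h']
      · exact (main r' hr' r hr h' (reach_symm hre)).symm
    · exact main r hr r' hr' h hre
  · refine EB_ext ?_ ?_ ?_ ?_
    · simp [mem_tr_e00, h00]
    · intro a; rw [mem_tr_eA, mem_RT_a]; simp
    · intro b; rw [mem_tr_eB, mem_RT_b]
    · intro e; rw [mem_tr_red, mem_redOf]

lemma tr_surj {T : Finset P.EB} (hT : IsSpanningTree P.endsB T) :
    ∃ R O, P.Good (P.redOf T) R O ∧ P.tr (P.redOf T) R O = T := by
  by_cases h00 : P.e00 ∈ T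
  · exact ⟨RT T, ∅, good_of_tree hT h00⟩
  · obtain ⟨g, hg⟩ := Pt.exists_edge (hT.2 (⊥ : P.W) (P.liftW ⊥)) (WithBot.bot_ne_coe)
    obtain ⟨hgT, w, hw, hwr⟩ := hg
    have hga : ∃ a, g = P.eA a ∧ w = P.liftW (P.liftV (P.aVert a)) := by
      rcases EB_cases g with rfl | ⟨a, rfl⟩ | ⟨b, rfl⟩ | ⟨e, rfl⟩
      · exact absurd hgT h00
      · refine ⟨a, rfl, ?_⟩
        have h : s((⊥ : P.W), P.liftW (P.liftV (P.aVert a))) = s(⊥, w) := hw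
        rw [Sym2.eq_iff] at h
        rcases h with ⟨_, h⟩ | ⟨_, h⟩
        · exact h.symm
        · exact absurd h WithBot.coe_ne_bot
      · have h : s(P.liftW ⊥, P.liftW (P.liftV (P.bVert b))) = s(⊥, w) := hw
        rw [Sym2.eq_iff] at h
        rcases h with ⟨h, _⟩ | ⟨_, h⟩ <;> exact absurd h WithBot.coe_ne_bot
      · obtain ⟨⟨u, v⟩, huv⟩ := Quot.exists_rep (P.endsRed e)
        have h := endsB_red huv.symm
        rw [hw, Sym2.eq_iff] at h
        rcases h with ⟨h, _⟩ | ⟨h, _⟩ <;> exact absurd h.symm WithBot.coe_ne_bot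
    obtain ⟨a, rfl, rfl⟩ := hga
    have hT' : IsSpanningTree P.endsB (insert P.e00 (T.erase (P.eA a))) :=
      tree_exchange hT (u := ⊥) (v := P.liftW (P.liftV (P.aVert a))) (a := ⊥) (b := P.liftW ⊥)
        hgT rfl rfl (reach_refl _ _) (reach_symm hwr)
    have hred : P.redOf (insert P.e00 (T.erase (P.eA a))) = P.redOf T := by
      ext e
      rw [mem_redOf, mem_redOf, Finset.mem_insert, Finset.mem_erase]
      have h1 := (e00_ne_red e).symm
      have h2 := (eA_ne_red a e).symm
      tauto
    obtain ⟨hG, -⟩ := good_of_tree hT' (Finset.mem_insert_self _ _)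
    rw [hred] at hG
    refine ⟨_, {P.liftV (P.aVert a)}, ⟨hG.bot, hG.ex, hG.un, by simp, ?_⟩, ?_⟩
    · rintro v rfl
      refine ⟨side_a a, ?_⟩
      intro r hr hre
      cases hs : P.side r with
      | false => rfl
      | true =>
        exfalso
        obtain ⟨a', rfl⟩ := exists_a_of_side hs
        have hm := mem_RT_a.1 hr
        have hm' : P.eA a' ∈ T.erase (P.eA a) := by simpa using hm
        have h1 : Reachable P.endsB (T.erase (P.eA a)) _ _ := reach_lift
          (fun e he => Finset.mem_erase.2 ⟨(eA_ne_red a e).symm, mem_redOf.1 he⟩) hre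
        refine hT.1 _ hgT _ _ hw (reach_trans ?_ (reach_symm h1))
        exact reach_edge hm' rfl
    · refine EB_ext ?_ ?_ ?_ ?_
      · simp [mem_tr_e00, h00]
      · intro a'
        rw [mem_tr_eA, mem_RT_a]
        by_cases h : a' = a
        · subst h
          simp [hgT]
        · have : P.liftV (P.aVert a') ∉ ({P.liftV (P.aVert a)} : Set P.Vred) :=
            fun h' => h (liftV_a_inj h')
          simp [this, h]
      · intro b; rw [mem_tr_eB, mem_RT_b]; simp
      · intro e; rw [mem_tr_red, mem_redOf]

/-- Step A: spanning trees are good root data. -/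
def treeEquiv {F : Finset P.Ered} (hF : IsAcyclic P.endsRed F) :
    {x : Set P.Vred × Set P.Vred // P.Good F x.1 x.2} ≃
      {T : Finset P.EB // IsSpanningTree P.endsB T ∧ P.redOf T = F} :=
  Equiv.ofBijective
    (fun x => ⟨P.tr F x.1.1 x.1.2, tr_tree hF x.2, redOf_tr _ _ _⟩)
    (by
      constructor
      · rintro ⟨⟨R, O⟩, h⟩ ⟨⟨R', O'⟩, h'⟩ he
        obtain ⟨h1, h2⟩ := tr_inj h h' (congrArg Subtype.val he)
        simp only at h1 h2
        subst h1
        subst h2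
        rfl
      · rintro ⟨T, hT, rfl⟩
        obtain ⟨R, O, hG, he⟩ := tr_surj hT
        exact ⟨⟨(R, O), hG⟩, Subtype.ext he⟩)

/-- Step B: good root data are families of local vertex configurations. -/
def rootEquiv (F : Finset P.Ered) :
    P.VFam F ≃ {x : Set P.Vred × Set P.Vred // P.Good F x.1 x.2} :=
  Equiv.ofBijective
    (fun g => ⟨({v | ∃ c, (g.1 c).1.1 = v}, {a | ∃ c, (g.1 c).1.2 = some a}), by
      obtain ⟨g, hg⟩ := g
      have hun : ∀ c c', Reachable P.endsRed F (g c).1.1 (g c').1.1 → c = c' := fun c c' h =>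
        Reps.eq_of_reach (reach_trans (reach_symm (g c).2.1) (reach_trans h (g c').2.1))
      refine ⟨?_, ?_, ?_, ?_, ?_⟩
      · exact ⟨⟨⊥, rep_b⟩, (g ⟨⊥, rep_b⟩).2.2.1 rfl⟩
      · intro v
        exact ⟨_, ⟨mkRep P.endsRed F ⊥ v, rfl⟩,
          reach_trans (rep_reach v) (reach_symm (g (mkRep P.endsRed F ⊥ v)).2.1)⟩
      · rintro _ ⟨c, rfl⟩ _ ⟨c', rfl⟩ h
        rw [hun c c' h]
      · rintro a ⟨c, hc⟩ a' ⟨c', hc'⟩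
        simp only at hc hc'
        have := hg c c' (by simp [hc]) (by simp [hc'])
        subst this
        rw [hc] at hc'
        simpa using hc'
      · rintro a ⟨c, hc⟩
        obtain ⟨h1, h2, h3⟩ := (g c).2.2.2 a hc
        refine ⟨h2, ?_⟩
        rintro _ ⟨c', rfl⟩ hr
        have : c = c' := Reps.eq_of_reach
          (reach_trans (reach_symm h1) (reach_trans hr (g c').2.1))
        subst this
        exact h3⟩)
    (by
      constructor
      · rintro ⟨g, hg⟩ ⟨g', hg'⟩ h
        have h := congrArg Subtype.val h
        simp only [Prod.mk.injEq] at h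
        obtain ⟨hR, hO⟩ := h
        refine Subtype.ext (funext fun c => Subtype.ext (Prod.ext ?_ ?_))
        · have h1 : (g c).1.1 ∈ {v | ∃ c, (g' c).1.1 = v} := by rw [← hR]; exact ⟨c, rfl⟩
          obtain ⟨c', hc'⟩ := h1
          have : c' = c := Reps.eq_of_reach (reach_trans (reach_symm (g' c').2.1)
            (by rw [hc']; exact (g c).2.1))
          subst this
          exact hc'.symm
        · have key : ∀ {g g' : ∀ c : Reps P.endsRed F ⊥,
                {p // VOK P.endsRed F ⊥ P.side c.1 p}},
              {a | ∃ c, (g c).1.2 = some a} = {a | ∃ c, (g' c).1.2 = some a} →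
              ∀ a, (g c).1.2 = some a → (g' c).1.2 = some a := by
            intro g g' hO a ha
            have h1 : a ∈ {a | ∃ c, (g' c).1.2 = some a} := by rw [← hO]; exact ⟨c, ha⟩
            obtain ⟨c', hc'⟩ := h1
            have : c' = c := Reps.eq_of_reach (reach_trans
              (reach_symm ((g' c').2.2.2 a hc').1) ((g c).2.2.2 a ha).1)
            subst this
            exact hc'
          exact Option.ext fun a => ⟨fun h => key hO a h, fun h => key hO.symm a h⟩
      · rintro ⟨⟨R, O⟩, hG⟩
        simp only at hG
        choose rt hrt1 hrt2 using hG.ex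
        let oo : P.Vred → Option P.Vred := fun c =>
          if h : ∃ a ∈ O, Reachable P.endsRed F a c then some h.choose else none
        have hoo : ∀ c a, oo c = some a → a ∈ O ∧ Reachable P.endsRed F a c := by
          intro c a h
          simp only [oo] at h
          split_ifs at h with h'
          obtain rfl : h'.choose = a := by simpa using h
          exact h'.choose_spec
        have hoo' : ∀ a ∈ O, ∀ c, Reachable P.endsRed F a c → oo c = some a := by
          intro a ha c hr
          have h' : ∃ a ∈ O, Reachable P.endsRed F a c := ⟨a, ha, hr⟩
          simp only [oo, dif_pos h']
          rw [hG.sub _ h'.choose_spec.1 _ ha]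
        refine ⟨⟨fun c => ⟨(rt c.1, oo c.1), reach_symm (hrt2 _), ?_, ?_⟩, ?_⟩, ?_⟩
        · intro hc
          have := hrt2 c.1
          rw [hc] at this
          simp only [hc]
          exact (hG.un _ hG.bot _ (hrt1 _) this).symm
        · intro a ha
          obtain ⟨h1, h2⟩ := hoo _ _ ha
          exact ⟨h2, (hG.sd a h1).1, (hG.sd a h1).2 _ (hrt1 _) (reach_trans h2 (hrt2 _))⟩
        · intro c c' hc hc'
          obtain ⟨a, ha⟩ := Option.ne_none_iff_exists'.1 hc
          obtain ⟨a', ha'⟩ := Option.ne_none_iff_exists'.1 hc'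
          obtain ⟨h1, h2⟩ := hoo _ _ ha
          obtain ⟨h1', h2'⟩ := hoo _ _ ha'
          rw [hG.sub _ h1' _ h1] at h2'
          exact Reps.eq_of_reach (reach_trans (reach_symm h2) h2')
        · refine Subtype.ext (Prod.ext ?_ ?_)
          · ext v
            constructor
            · rintro ⟨c, rfl⟩
              exact hrt1 _
            · intro hv
              refine ⟨mkRep P.endsRed F ⊥ v, ?_⟩
              exact (hG.un _ hv _ (hrt1 _) (reach_trans (rep_reach v) (hrt2 _))).symm
          · ext a
            constructor
            · rintro ⟨c, hc⟩
              exact (hoo _ _ hc).1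
            · intro ha
              exact ⟨mkRep P.endsRed F ⊥ a, hoo' a ha _ (rep_reach a)⟩)

/-- The bijection with fixed underlying forest. -/
def fiberEquiv {F : Finset P.Ered} (hF : IsAcyclic P.endsRed F) :
    {T : Finset P.EB // IsSpanningTree P.endsB T ∧ P.redOf T = F} ≃
      {mult : P.Ered → ℕ // P.Is2ERF mult ∧ P.mSupport mult = F} :=
  (treeEquiv hF).symm.trans ((rootEquiv F).symm.trans ((famEquiv hF).trans (multEquiv hF).symm))

end BiconedGraph

/-- Corollary 3.6.  For any biconed graph `G^{A,B}` there is
a bijection between the set of spanning trees of `G^{A,B}` and the set of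
2-edge-rooted forests of `G^{A,B}_red`. -/
theorem spanningTrees_equiv_twoEdgeRootedForests (P : BiconedGraph) :
    Nonempty ({T : Finset P.EB // IsSpanningTree P.endsB T} ≃
      {mult : P.Ered → ℕ // P.Is2ERF mult}) := by
  let f : {T : Finset P.EB // IsSpanningTree P.endsB T} →
      {F : Finset P.Ered // IsAcyclic P.endsRed F} :=
    fun T => ⟨P.redOf T.1, BiconedGraph.redOf_acyclic T.2.1⟩
  let g : {mult : P.Ered → ℕ // P.Is2ERF mult} →
      {F : Finset P.Ered // IsAcyclic P.endsRed F} :=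
    fun mult => ⟨P.mSupport mult.1, mult.2.1⟩
  refine ⟨(Equiv.sigmaFiberEquiv f).symm.trans
    ((Equiv.sigmaCongrRight fun F => ?_).trans (Equiv.sigmaFiberEquiv g))⟩
  refine Equiv.trans ?_ ((BiconedGraph.fiberEquiv F.2).trans ?_)
  · exact (Equiv.subtypeEquivRight fun T => by simp [f, Subtype.ext_iff]).trans
      (Equiv.subtypeSubtypeEquivSubtypeInter (fun T => IsSpanningTree P.endsB T)
        (fun T => P.redOf T = F.1))
  · exact ((Equiv.subtypeEquivRight fun T => by simp [g, Subtype.ext_iff]).trans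
      (Equiv.subtypeSubtypeEquivSubtypeInter (fun mult => P.Is2ERF mult)
        (fun mult => P.mSupport mult = F.1))).symm

end

end BiconedPaper
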